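/- Let R be a Noetherian local ring with maximal ideal m and residue field k, and suppose x ∈ m \ m² is a nonzerodivisor. If R/(x) is a complete intersection ring, then R is a complete intersection ring. -/

import Mathlib

open IsLocalRing RingTheory.Sequence

/-- A Noetherian local ring is *regular* iff its maximal ideal can be
generated by a regular sequence. -/
def IsRegularLocal (S : Type) [CommRing S] [IsLocalRing S] : Prop :=
  IsNoetherianRing S ∧
    ∃ rs : List S, IsRegular S rs ∧ Ideal.span {x | x ∈ rs} = maximalIdeal S

/-- A Noetherian local ring `R` is a *complete intersection* if its `m`-adic
completion is isomorphic to a quotient of a regular local ring by an ideal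
generated by a regular sequence (of elements of the maximal ideal). -/
def IsCompleteIntersectionRing (R : Type) [CommRing R] [IsLocalRing R] : Prop :=
  IsNoetherianRing R ∧
    ∃ (S : Type) (_ : CommRing S) (_ : IsLocalRing S) (rs : List S),
      IsRegularLocal S ∧ (∀ x ∈ rs, x ∈ maximalIdeal S) ∧ IsRegular S rs ∧
        Nonempty ((AdicCompletion (maximalIdeal R) R) ≃+*
          (S ⧸ Ideal.span {x | x ∈ rs}))

theorem exists_limit_of_sub_mem {U : Type*} [CommRing U] (I : Ideal U) [IsPrecomplete I U]
    (s : ℕ → U) (h : ∀ n, s (n + 1) - s n ∈ I ^ n) : ∃ L, ∀ n, s n - L ∈ I ^ n := by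
  have key : ∀ m k, s m - s (m + k) ∈ I ^ m := by
    intro m k
    induction k with
    | zero => simp
    | succ k ih =>
      have := Ideal.pow_le_pow_right (Nat.le_add_right m k) (h (m + k))
      convert sub_mem ih this using 1
      rw [← add_assoc]
      ring
  obtain ⟨L, hL⟩ := IsPrecomplete.prec' (I := I) (M := U) s (by
    intro m n hmn
    obtain ⟨k, rfl⟩ := Nat.exists_eq_add_of_le hmn
    simpa [SModEq.sub_mem] using key m k)
  exact ⟨L, fun n => by simpa [SModEq.sub_mem] using hL n⟩

theorem exists_limit_sum {U : Type*} [CommRing U] (I : Ideal U) [IsPrecomplete I U] (D : ℕ)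
    (c : ℕ → U) (h : ∀ n, c n ∈ I ^ (n - D)) :
    ∃ L, ∀ n, ∑ d ∈ Finset.range n, c d - L ∈ I ^ (n - D) := by
  obtain ⟨L, hL⟩ := exists_limit_of_sub_mem I (fun n => ∑ d ∈ Finset.range (n + D), c d) (by
    intro n
    have := h (n + D)
    rw [Nat.add_sub_cancel] at this
    simpa [Nat.add_right_comm n 1 D, Finset.sum_range_succ] using this)
  refine ⟨L, fun n => ?_⟩
  rcases le_total D n with hn | hn
  · simpa [Nat.sub_add_cancel hn] using hL (n - D)
  · simp [Nat.sub_eq_zero_of_le hn]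

theorem eq_zero_of_forall_mem_pow {U : Type*} [CommRing U] (I : Ideal U) [IsHausdorff I U]
    {x : U} (h : ∀ n, x ∈ I ^ n) : x = 0 :=
  IsHausdorff.haus' (I := I) x fun n => by simpa [SModEq.zero] using h n

/-- An ideal is generated by a finite family as soon as the family generates it up to higher
order terms. -/
theorem le_span_of_approximation {U ι : Type*} [CommRing U] [Fintype ι] (I : Ideal U)
    [IsAdicComplete I U] (J : Ideal U) (g : ι → U) (hg : ∀ i, g i ∈ J) (D : ℕ)
    (H : ∀ d, ∀ z ∈ J, z ∈ I ^ d →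
      ∃ c : ι → U, (∀ i, c i ∈ I ^ (d - D)) ∧ z - ∑ i, c i * g i ∈ I ^ (d + 1)) :
    J ≤ Ideal.span (Set.range g) := by
  intro z hz
  let T (d : ℕ) := {z : U // z ∈ J ∧ z ∈ I ^ d}
  choose c hc hc' using H
  have hJ (w : U) (hw : w ∈ J) (c : ι → U) : w - ∑ i, c i * g i ∈ J :=
    sub_mem hw (sum_mem fun i _ => J.mul_mem_left _ (hg i))
  let zs : ∀ d, T d := fun d => Nat.rec ⟨z, hz, by simp⟩
    (fun d w => ⟨_, hJ _ w.2.1 (c d w.1 w.2.1 w.2.2), hc' d w.1 w.2.1 w.2.2⟩) d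
  let a (d : ℕ) : ι → U := c d (zs d).1 (zs d).2.1 (zs d).2.2
  have hzs (d : ℕ) : (zs (d + 1)).1 = (zs d).1 - ∑ i, a d i * g i := rfl
  have hsum (n : ℕ) : z - ∑ i, (∑ d ∈ Finset.range n, a d i) * g i = (zs n).1 := by
    induction n with
    | zero => simp; rfl
    | succ n ih =>
      rw [hzs, ← ih]
      simp only [Finset.sum_range_succ, add_mul, Finset.sum_add_distrib]
      ring
  choose L hL using fun i => exists_limit_sum I D (fun d => a d i) (fun d => hc _ _ _ _ i)
  have : z - ∑ i, L i * g i = 0 := by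
    apply eq_zero_of_forall_mem_pow I
    intro n
    have h1 : z - ∑ i, L i * g i = (zs (n + D)).1 +
        ∑ i, (∑ d ∈ Finset.range (n + D), a d i - L i) * g i := by
      rw [← hsum]
      simp only [sub_mul, Finset.sum_sub_distrib]
      ring
    rw [h1]
    refine add_mem (Ideal.pow_le_pow_right (by omega) (zs (n + D)).2.2)
      (sum_mem fun i _ => Ideal.mul_mem_right _ _ ?_)
    simpa using hL i (n + D)
  rw [sub_eq_zero.mp this]
  exact sum_mem fun i _ => Ideal.mul_mem_left _ _ (Ideal.subset_span ⟨i, rfl⟩)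

theorem eval_mem_pow_of_isHomogeneous {U σ : Type*} [CommRing U] (I : Ideal U) (y : σ → U)
    (hy : ∀ i, y i ∈ I) {d : ℕ} {F : MvPolynomial σ U} (hF : F.IsHomogeneous d) :
    MvPolynomial.eval y F ∈ I ^ d := by
  have : MvPolynomial.eval y F ∈ Ideal.span (Set.range y) ^ d :=
    (Ideal.mem_span_pow_iff_exists_isHomogeneous y _).mpr ⟨F, hF, rfl⟩
  exact Ideal.pow_right_mono (Ideal.span_le.mpr (by rintro _ ⟨i, rfl⟩; exact hy i)) d this

theorem eval_mem_pow_succ_of_isHomogeneous {U σ : Type*} [CommRing U] (I : Ideal U) (y : σ → U)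
    (hy : ∀ i, y i ∈ I) {d : ℕ} {F : MvPolynomial σ U} (hF : F.IsHomogeneous d)
    (h0 : MvPolynomial.map (Ideal.Quotient.mk I) F = 0) :
    MvPolynomial.eval y F ∈ I ^ (d + 1) := by
  rw [MvPolynomial.eval_eq]
  refine sum_mem fun m hm => ?_
  rw [pow_succ']
  refine Ideal.mul_mem_mul ?_ ?_
  · rw [← Ideal.Quotient.eq_zero_iff_mem, ← MvPolynomial.coeff_map, h0, MvPolynomial.coeff_zero]
  · convert eval_mem_pow_of_isHomogeneous I y hy
      (MvPolynomial.isHomogeneous_monomial (1 : U) (n := d) (d := m) ?_) using 1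
    · simp [MvPolynomial.eval_monomial, Finsupp.prod]
    · by_contra hne
      exact (MvPolynomial.mem_support_iff.mp hm) (hF.coeff_eq_zero hne)

theorem homogeneousComponent_mul_of_isHomogeneous {R σ : Type*} [CommRing R] {d : ℕ}
    {F : MvPolynomial σ R} (hF : F.IsHomogeneous d) (e : ℕ) (a : MvPolynomial σ R) :
    MvPolynomial.homogeneousComponent e (a * F) =
      if d ≤ e then MvPolynomial.homogeneousComponent (e - d) a * F else 0 := by
  classical
  letI : GradedAlgebra (MvPolynomial.homogeneousSubmodule σ R) := MvPolynomial.gradedAlgebra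
  have key (n : ℕ) (p : MvPolynomial σ R) : MvPolynomial.homogeneousComponent n p =
      DirectSum.decompose (MvPolynomial.homogeneousSubmodule σ R) p n :=
    (MvPolynomial.decomposition.decompose'_apply p n).symm
  rw [key, key]
  exact DirectSum.coe_decompose_mul_of_right_mem (MvPolynomial.homogeneousSubmodule σ R) e
    (a := a) (show F ∈ MvPolynomial.homogeneousSubmodule σ R d from hF)

theorem isNoetherianRing_of_isAdicComplete {U : Type*} [CommRing U] {n : ℕ} (y : Fin n → U)
    [IsAdicComplete (Ideal.span (Set.range y)) U]
    [IsNoetherianRing (U ⧸ Ideal.span (Set.range y))] : IsNoetherianRing U := by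
  set I := Ideal.span (Set.range y) with hI
  have hyI (i) : y i ∈ I := Ideal.subset_span ⟨i, rfl⟩
  refine ⟨fun J => ?_⟩
  let 𝒮 : Set (MvPolynomial (Fin n) (U ⧸ I)) := {G | ∃ (d : ℕ) (F : MvPolynomial (Fin n) U) (z : U),
    F.IsHomogeneous d ∧ z ∈ J ∧ z - MvPolynomial.eval y F ∈ I ^ (d + 1) ∧
      MvPolynomial.map (Ideal.Quotient.mk I) F = G}
  obtain ⟨s, hs, hspan⟩ := (Submodule.fg_span_iff_fg_span_finset_subset 𝒮).mp
    (IsNoetherian.noetherian (Submodule.span (MvPolynomial (Fin n) (U ⧸ I)) 𝒮))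
  have hs' : ∀ G ∈ s, G ∈ 𝒮 := fun G hG => hs hG
  choose! d F g hF hg hgF hmap using hs'
  let D := s.sup d
  suffices J = Ideal.span (Set.range fun i : s => g i) by
    rw [this]
    exact Submodule.fg_span (Set.finite_range _)
  refine le_antisymm (le_span_of_approximation I J _ (fun i => hg i i.2) D ?_)
    (Ideal.span_le.mpr ?_)
  swap
  · rintro _ ⟨i, rfl⟩
    exact hg i i.2
  intro e z hz hze
  obtain ⟨P, hP, hPz⟩ := (Ideal.mem_span_pow_iff_exists_isHomogeneous y z).mp hze
  have hmem : MvPolynomial.map (Ideal.Quotient.mk I) P ∈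
      Submodule.span (MvPolynomial (Fin n) (U ⧸ I)) (s : Set (MvPolynomial (Fin n) (U ⧸ I))) := by
    rw [← hspan]
    exact Submodule.subset_span ⟨e, P, z, hP, hz, by simp [hPz], rfl⟩
  obtain ⟨a, -, ha⟩ := Submodule.mem_span_finset.mp hmem
  choose b hb using fun G => MvPolynomial.map_surjective (Ideal.Quotient.mk I)
    Ideal.Quotient.mk_surjective (a G)
  classical
  let c (G : MvPolynomial (Fin n) (U ⧸ I)) : MvPolynomial (Fin n) U :=
    if d G ≤ e then MvPolynomial.homogeneousComponent (e - d G) (b G) else 0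
  have hc (G) : (c G).IsHomogeneous (e - d G) := by
    simp only [c]
    split_ifs
    · exact MvPolynomial.homogeneousComponent_isHomogeneous _ _
    · exact MvPolynomial.isHomogeneous_zero _ _ _
  have hcF (G) (hG : G ∈ s) : (c G * F G).IsHomogeneous e := by
    by_cases h : d G ≤ e
    · simpa [Nat.sub_add_cancel h] using (hc G).mul (hF G hG)
    · simp [c, h, MvPolynomial.isHomogeneous_zero]
  have hcomp : MvPolynomial.map (Ideal.Quotient.mk I) (P - ∑ G ∈ s, c G * F G) = 0 := by
    rw [map_sub, sub_eq_zero, ← MvPolynomial.homogeneousComponent_eq_self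
      (hP.map (Ideal.Quotient.mk I)), ← ha, map_sum, map_sum]
    refine Finset.sum_congr rfl fun G hG => ?_
    have hGd : G.IsHomogeneous (d G) := by
      have := (hF G hG).map (Ideal.Quotient.mk I)
      rwa [hmap G hG] at this
    rw [smul_eq_mul, homogeneousComponent_mul_of_isHomogeneous hGd, map_mul, hmap G hG]
    simp only [c]
    split_ifs
    · congr 1
      rw [← hb G]
      ext m
      simp only [MvPolynomial.coeff_homogeneousComponent, MvPolynomial.coeff_map]
      split_ifs <;> simp
    · simp
  refine ⟨fun G => MvPolynomial.eval y (c G), fun G => ?_, ?_⟩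
  · exact Ideal.pow_le_pow_right (Nat.sub_le_sub_left (Finset.le_sup G.2) e)
      (eval_mem_pow_of_isHomogeneous I y hyI (hc G))
  have h1 := eval_mem_pow_succ_of_isHomogeneous I y hyI
    (hP.sub (MvPolynomial.IsHomogeneous.sum s _ e hcF)) hcomp
  rw [map_sub, hPz, map_sum] at h1
  rw [Finset.sum_coe_sort s (fun G => MvPolynomial.eval y (c G) * g G)]
  have h2 : ∑ G ∈ s, MvPolynomial.eval y (c G) * (g G - MvPolynomial.eval y (F G)) ∈ I ^ (e + 1) := by
    refine sum_mem fun G hG => ?_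
    by_cases h : d G ≤ e
    · have := Ideal.mul_mem_mul (eval_mem_pow_of_isHomogeneous I y hyI (hc G)) (hgF G hG)
      rwa [← pow_add, ← add_assoc, Nat.sub_add_cancel h] at this
    · simp [c, h]
  convert sub_mem h1 h2 using 1
  simp only [mul_sub, Finset.sum_sub_distrib, map_mul]
  ring

theorem isLocalRing_quotient_span_singleton {R : Type*} [CommRing R] [IsLocalRing R] {x : R}
    (hx : x ∈ maximalIdeal R) : IsLocalRing (R ⧸ Ideal.span {x}) := by
  have : Nontrivial (R ⧸ Ideal.span {x}) := Ideal.Quotient.nontrivial_iff.mpr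
    (ne_top_of_le_ne_top (Ideal.IsPrime.ne_top') ((Ideal.span_singleton_le_iff_mem _).mpr hx))
  exact IsLocalRing.of_surjective' _ Ideal.Quotient.mk_surjective

/-- The elements `y` and `f i` of the ideal `q` satisfy no relation modulo `q ^ 2` other than
those with all coefficients in `q`. -/
structure IsIndependentModSq {R ι : Type*} [CommRing R] [Fintype ι] (q : Ideal R) (y : R)
    (f : ι → R) : Prop where
  mem : y ∈ q
  mem_right : ∀ i, f i ∈ q
  coeff_mem : ∀ a (b : ι → R), a * y + ∑ i, b i * f i ∈ q ^ 2 → a ∈ q ∧ ∀ i, b i ∈ q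

theorem exists_isIndependentModSq {R : Type*} [CommRing R] [IsLocalRing R] [IsNoetherianRing R]
    {x : R} (hx : x ∈ maximalIdeal R) (hx2 : x ∉ maximalIdeal R ^ 2) :
    ∃ (n : ℕ) (f : Fin n → R), IsIndependentModSq (maximalIdeal R) x f ∧
      Ideal.span {x} ⊔ Ideal.span (Set.range f) = maximalIdeal R ∧
      n + 1 = (maximalIdeal R).spanFinrank := by
  set m := maximalIdeal R
  let κ := ResidueField R
  let v : CotangentSpace R := m.toCotangent ⟨x, hx⟩
  have hv : v ≠ 0 := by
    rw [Ne, Ideal.toCotangent_eq_zero]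
    exact hx2
  let W := CotangentSpace R ⧸ Submodule.span κ {v}
  let b := Module.finBasis κ W
  have hsurj : Function.Surjective
      fun z : m => (Submodule.span κ {v}).mkQ (m.toCotangent z) :=
    (Submodule.mkQ_surjective _).comp m.toCotangent_surjective
  choose f hf using fun i => hsurj (b i)
  have hli : LinearIndependent κ (Fin.cons v fun i => m.toCotangent (f i) :
      Fin (Module.finrank κ W + 1) → CotangentSpace R) := by
    rw [Fintype.linearIndependent_iff]
    intro g hg
    rw [Fin.sum_univ_succ] at hg
    simp only [Fin.cons_zero, Fin.cons_succ] at hg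
    have h1 := congrArg (Submodule.span κ {v}).mkQ hg
    have h0 : (Submodule.span κ {v}).mkQ v = 0 := by
      simp [Submodule.mem_span_singleton_self]
    rw [map_add, map_smul, h0, smul_zero, zero_add, map_sum, map_zero] at h1
    simp only [map_smul, hf] at h1
    have h2 := Fintype.linearIndependent_iff.mp b.linearIndependent _ h1
    simp only [h2, zero_smul, Finset.sum_const_zero, add_zero] at hg
    intro i
    refine Fin.cases ?_ h2 i
    exact (smul_eq_zero.mp hg).resolve_right hv
  have hrank : Module.finrank κ W + 1 = Module.finrank κ (CotangentSpace R) := by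
    rw [← Submodule.finrank_quotient_add_finrank (Submodule.span κ {v}), finrank_span_singleton hv]
  refine ⟨Module.finrank κ W, fun i => f i, ⟨hx, fun i => (f i).2, fun a c hac => ?_⟩, ?_, ?_⟩
  · have h1 : a • (⟨x, hx⟩ : m) + ∑ i, c i • f i ∈ LinearMap.ker m.toCotangent := by
      rw [Ideal.mem_toCotangent_ker]
      simpa using hac
    rw [LinearMap.mem_ker, map_add, map_sum] at h1
    have h2 := Fintype.linearIndependent_iff.mp hli
      (Fin.cons (residue R a) fun i => residue R (c i)) (by
        rw [Fin.sum_univ_succ]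
        simp only [Fin.cons_zero, Fin.cons_succ]
        simp only [map_smul] at h1
        exact h1)
    refine ⟨?_, fun i => ?_⟩
    · exact (residue_eq_zero_iff a).mp (h2 0)
    · exact (residue_eq_zero_iff (c i)).mp (h2 i.succ)
  · have h1 := hli.span_eq_top_of_card_eq_finrank' (by simpa using hrank)
    have h2 : Set.range (Fin.cons v fun i => m.toCotangent (f i) :
        Fin (Module.finrank κ W + 1) → CotangentSpace R) =
        m.toCotangent '' (insert ⟨x, hx⟩ (Set.range f)) := by
      rw [Fin.range_cons, Set.image_insert_eq, ← Set.range_comp]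
      rfl
    rw [h2, CotangentSpace.span_image_eq_top_iff] at h1
    have h3 := congrArg (Submodule.map m.subtype) h1
    rw [Submodule.map_span, Submodule.map_top, Submodule.range_subtype, Set.image_insert_eq,
      ← Set.range_comp] at h3
    rw [← Ideal.span_union, ← Set.insert_eq]
    exact h3
  · rw [hrank, spanFinrank_maximalIdeal_eq_finrank_cotangentSpace]

theorem spanFinrank_maximalIdeal_quotient_lt {R : Type*} [CommRing R] [IsLocalRing R]
    [IsNoetherianRing R] {x : R} (hx : x ∈ maximalIdeal R) (hx2 : x ∉ maximalIdeal R ^ 2)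
    [IsLocalRing (R ⧸ Ideal.span {x})] :
    (maximalIdeal (R ⧸ Ideal.span {x})).spanFinrank + 1 ≤ (maximalIdeal R).spanFinrank := by
  obtain ⟨n, f, -, hspan, hn⟩ := exists_isIndependentModSq hx hx2
  rw [← hn, add_le_add_iff_right]
  have h0 : Ideal.Quotient.mk (Ideal.span {x}) x = 0 :=
    Ideal.Quotient.eq_zero_iff_mem.mpr (Ideal.mem_span_singleton_self x)
  have : maximalIdeal (R ⧸ Ideal.span {x}) =
      Ideal.span (Set.range fun i => Ideal.Quotient.mk (Ideal.span {x}) (f i)) := by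
    rw [← map_maximalIdeal_of_surjective _ (Ideal.Quotient.mk_surjective (I := Ideal.span {x})),
      ← hspan, Ideal.map_sup, Ideal.map_span, Ideal.map_span, Set.image_singleton, h0,
      ← Set.range_comp]
    simp [Function.comp_def]
  rw [this]
  refine (Submodule.spanFinrank_span_le_ncard_of_finite (Set.finite_range _)).trans ?_
  rw [← Set.image_univ]
  exact (Set.ncard_image_le Set.finite_univ).trans (by simp)

theorem IsRegularLocalRing.quotient_span_singleton {R : Type*} [CommRing R] [IsRegularLocalRing R]
    {x : R} (hx : x ∈ maximalIdeal R) (hx2 : x ∉ maximalIdeal R ^ 2) :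
    IsRegularLocalRing (R ⧸ Ideal.span {x}) := by
  have := isLocalRing_quotient_span_singleton hx
  apply IsRegularLocalRing.of_spanFinrank_maximalIdeal_le
  rw [← ENat.WithBot.add_le_add_one_right_iff]
  calc _ ≤ ((maximalIdeal R).spanFinrank : WithBot ℕ∞) := by
        exact_mod_cast spanFinrank_maximalIdeal_quotient_lt hx hx2
    _ = ringKrullDim R := IsRegularLocalRing.spanFinrank_maximalIdeal
    _ ≤ _ := by
      have h1 : Ideal.span {x} ≤ Ring.jacobson R := by
        rw [IsLocalRing.ringJacobson_eq_maximalIdeal]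
        exact (Ideal.span_singleton_le_iff_mem _).mpr hx
      have h2 := ringKrullDim_le_ringKrullDim_quotient_add_spanFinrank _ h1
      refine h2.trans ?_
      gcongr
      have := Submodule.spanFinrank_span_le_ncard_of_finite (R := R) (Set.finite_singleton x)
      rw [Set.ncard_singleton] at this
      exact_mod_cast this

theorem isDomain_of_isPrime_span_singleton {R : Type*} [CommRing R] [IsLocalRing R]
    [IsNoetherianRing R] {x : R} (hx : x ∈ maximalIdeal R) [hprime : (Ideal.span {x}).IsPrime]
    (hmin : ∀ p ∈ minimalPrimes R, x ∉ p) : IsDomain R := by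
  obtain ⟨p, hp, hpx⟩ := Ideal.exists_minimalPrimes_le (bot_le (a := Ideal.span {x}))
  have hpp : p.IsPrime := hp.1.1
  have : p = ⊥ := by
    refine Submodule.eq_bot_of_le_smul_of_le_jacobson_bot (maximalIdeal R) p
      (IsNoetherian.noetherian _) ?_ (jacobson_eq_maximalIdeal _ bot_ne_top).ge
    intro q hq
    obtain ⟨r, rfl⟩ := Ideal.mem_span_singleton'.mp (hpx hq)
    have hr := (hpp.mem_or_mem hq).resolve_right (hmin p hp)
    rw [mul_comm]
    exact Submodule.smul_mem_smul hx hr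
  rw [this] at hpp
  exact IsDomain.of_bot_isPrime R

theorem IsRegularLocalRing.isDomain_of_spanFinrank_le (d : ℕ) : ∀ (R : Type*) [CommRing R]
    [IsRegularLocalRing R], (maximalIdeal R).spanFinrank ≤ d → IsDomain R := by
  induction d with
  | zero =>
    intro R _ _ h
    rw [nonpos_iff_eq_zero, spanFinrank_maximalIdeal_eq_finrank_cotangentSpace,
      finrank_cotangentSpace_eq_zero_iff] at h
    exact h.isDomain
  | succ d ih =>
    intro R _ _ h
    by_cases hf : IsField R
    · exact hf.isDomain
    have hfin := Ideal.finite_minimalPrimes_of_isNoetherianRing R ⊥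
    have : ¬ ((maximalIdeal R : Set R) ⊆ ⋃ i ∈ (↑(insert (maximalIdeal R ^ 2) hfin.toFinset) :
        Set (Ideal R)), ((id i : Ideal R) : Set R)) := by
      classical
      rw [Ideal.subset_union_prime (maximalIdeal R ^ 2) (maximalIdeal R ^ 2)]
      · simp only [Finset.mem_insert, Set.Finite.mem_toFinset, not_exists, not_and, id]
        rintro p (rfl | hp) hle
        · have : maximalIdeal R = ⊥ := by
            refine Submodule.eq_bot_of_le_smul_of_le_jacobson_bot (maximalIdeal R) _
              (IsNoetherian.noetherian _) ?_ (jacobson_eq_maximalIdeal _ bot_ne_top).ge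
            rwa [smul_eq_mul, ← sq]
          exact hf (isField_iff_maximalIdeal_eq.mpr this)
        · have : Ring.KrullDimLE 0 R := Ring.KrullDimLE.mk₀ fun q hq => by
            have hle' : maximalIdeal R ≤ q :=
              hle.trans (hp.2 ⟨hq, bot_le⟩ ((le_maximalIdeal hq.ne_top).trans hle))
            rw [← (maximalIdeal.isMaximal R).eq_of_le hq.ne_top hle']
            exact maximalIdeal.isMaximal R
          have h1 : ((maximalIdeal R).spanFinrank : WithBot ℕ∞) = 0 := by
            rw [IsRegularLocalRing.spanFinrank_maximalIdeal]
            exact ringKrullDimZero_iff_ringKrullDim_eq_zero.mp this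
          rw [Nat.cast_eq_zero, spanFinrank_maximalIdeal_eq_finrank_cotangentSpace,
            finrank_cotangentSpace_eq_zero_iff] at h1
          exact hf h1
      · intro p hp hne _
        simp only [Finset.mem_insert, Set.Finite.mem_toFinset] at hp
        exact (hp.resolve_left hne).1.1
    obtain ⟨x, hx, hx'⟩ := Set.not_subset.mp this
    simp only [Finset.coe_insert, Set.Finite.coe_toFinset, Set.mem_insert_iff, Set.mem_iUnion,
      not_exists, id] at hx'
    have hx2 := hx' _ (Or.inl rfl)
    have := IsRegularLocalRing.quotient_span_singleton hx hx2
    have hd := ih (R ⧸ Ideal.span {x}) (by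
      have := spanFinrank_maximalIdeal_quotient_lt hx hx2
      omega)
    have := (Ideal.Quotient.isDomain_iff_prime _).mp hd
    exact isDomain_of_isPrime_span_singleton hx fun p hp => hx' p (Or.inr hp)

theorem IsRegularLocalRing.isDomain (R : Type*) [CommRing R] [IsRegularLocalRing R] : IsDomain R :=
  IsRegularLocalRing.isDomain_of_spanFinrank_le _ R le_rfl

theorem Ideal.exists_eq_of_mem_sup_pow_succ {R : Type*} [CommRing R] (g : R) (J : Ideal R) (j : ℕ)
    {z : R} (hz : z ∈ (Ideal.span {g} ⊔ J) ^ (j + 1)) :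
    ∃ u ∈ (Ideal.span {g} ⊔ J) ^ j, ∃ v ∈ J ^ (j + 1), z = g * u + v := by
  have key : ∀ j, (Ideal.span {g} ⊔ J) ^ (j + 1) ≤
      Ideal.span {g} * (Ideal.span {g} ⊔ J) ^ j ⊔ J ^ (j + 1) := by
    intro j
    induction j with
    | zero => simp
    | succ j ih =>
      rw [pow_succ', Ideal.sup_mul]
      refine sup_le le_sup_left ?_
      refine (Ideal.mul_mono_right ih).trans ?_
      rw [Ideal.mul_sup, ← pow_succ' J]
      refine sup_le_sup ?_ le_rfl
      rw [mul_left_comm, pow_succ' _ j]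
      exact Ideal.mul_mono_right (Ideal.mul_mono_left le_sup_right)
  obtain ⟨a, ha, v, hv, rfl⟩ := Submodule.mem_sup.mp (key j hz)
  obtain ⟨u, hu, rfl⟩ := Ideal.mem_span_singleton_mul.mp ha
  exact ⟨u, hu, v, hv, rfl⟩

theorem Ideal.span_range_fin_succ {R : Type*} [CommRing R] {n : ℕ} (f : Fin (n + 1) → R) :
    Ideal.span (Set.range f) =
      Ideal.span {f 0} ⊔ Ideal.span (Set.range fun i : Fin n => f i.succ) := by
  rw [← Fin.cons_self_tail f, Fin.range_cons, Set.insert_eq, Ideal.span_union]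
  rfl

namespace IsIndependentModSq

theorem notMem_sq {R ι : Type*} [CommRing R] [Fintype ι] {q : Ideal R} (hq : q ≠ ⊤) {y : R}
    {f : ι → R} (h : IsIndependentModSq q y f) : y ∉ q ^ 2 := fun hy =>
  hq ((Ideal.eq_top_iff_one q).mpr (h.coeff_mem 1 0 (by simpa using hy)).1)

variable {R : Type*} [CommRing R] {n : ℕ} {q : Ideal R} {y : R}
  {f : Fin (n + 1) → R}

theorem head (h : IsIndependentModSq q y f) : IsIndependentModSq q (f 0) fun i : Fin n => f i.succ := by
  refine ⟨h.mem_right 0, fun i => h.mem_right _, fun a b hab => ?_⟩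
  have := (h.coeff_mem 0 (Fin.cons a b) (by simpa [Fin.sum_univ_succ] using hab)).2
  exact ⟨this 0, fun i => this i.succ⟩

theorem quotient [IsLocalRing R] [IsLocalRing (R ⧸ Ideal.span {f 0})]
    (h : IsIndependentModSq (maximalIdeal R) y f) :
    IsIndependentModSq (maximalIdeal (R ⧸ Ideal.span {f 0})) (Ideal.Quotient.mk _ y)
      fun i : Fin n => Ideal.Quotient.mk _ (f i.succ) := by
  have hs := Ideal.Quotient.mk_surjective (I := Ideal.span {f 0})
  rw [← map_maximalIdeal_of_surjective _ hs]
  refine ⟨Ideal.mem_map_of_mem _ h.mem, fun i => Ideal.mem_map_of_mem _ (h.mem_right _), ?_⟩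
  intro a b hab
  obtain ⟨a, rfl⟩ := hs a
  obtain ⟨b, rfl⟩ := hs.comp_left b
  rw [← Ideal.map_pow, Ideal.mem_map_iff_of_surjective _ hs] at hab
  obtain ⟨w, hw, hwe⟩ := hab
  have h1 : w - (a * y + ∑ i, b i * f i.succ) ∈ Ideal.span {f 0} := by
    rw [← Ideal.Quotient.eq_zero_iff_mem, map_sub, hwe]
    simp
  obtain ⟨c, hc⟩ := Ideal.mem_span_singleton'.mp h1
  have h2 := h.coeff_mem a (Fin.cons c b) (by
    rw [Fin.sum_univ_succ]
    simp only [Fin.cons_zero, Fin.cons_succ]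
    convert hw using 1
    rw [hc]
    ring)
  exact ⟨Ideal.mem_map_of_mem _ h2.1, fun i => Ideal.mem_map_of_mem _ (h2.2 i.succ)⟩

end IsIndependentModSq

theorem IsRegularLocalRing.quotient_of_isIndependentModSq {R : Type*} [CommRing R]
    [IsRegularLocalRing R] {n : ℕ} {y : R} {f : Fin (n + 1) → R}
    (h : IsIndependentModSq (maximalIdeal R) y f) : IsRegularLocalRing (R ⧸ Ideal.span {f 0}) :=
  .quotient_span_singleton h.head.mem (h.head.notMem_sq Ideal.IsPrime.ne_top')

theorem mem_map_mk_iff {R : Type*} [CommRing R] (g : R) (J : Ideal R) (z : R) :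
    Ideal.Quotient.mk (Ideal.span {g}) z ∈ J.map (Ideal.Quotient.mk (Ideal.span {g})) ↔
      z ∈ J ⊔ Ideal.span {g} := by
  rw [← Ideal.mem_comap, Ideal.comap_map_of_surjective _ Ideal.Quotient.mk_surjective,
    ← RingHom.ker_eq_comap_bot, Ideal.mk_ker]

theorem map_mk_span_range {R ι : Type*} [CommRing R] (I : Ideal R) (f : ι → R) :
    (Ideal.span (Set.range f)).map (Ideal.Quotient.mk I) =
      Ideal.span (Set.range fun i => Ideal.Quotient.mk I (f i)) := by
  rw [Ideal.map_span, ← Set.range_comp]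
  rfl

namespace IsRegularLocalRing

theorem mem_pow_span_of_mul_mem (n : ℕ) : ∀ {R : Type*} [CommRing R] [IsRegularLocalRing R] {y : R}
    {f : Fin n → R}, IsIndependentModSq (maximalIdeal R) y f → ∀ (j : ℕ) {z : R},
    y * z ∈ Ideal.span (Set.range f) ^ j → z ∈ Ideal.span (Set.range f) ^ j := by
  induction n with
  | zero =>
    intro R _ _ y f h j z hz
    have := IsRegularLocalRing.isDomain R
    rcases j with _ | j
    · simp
    have hy : y ≠ 0 := by
      rintro rfl
      exact h.notMem_sq Ideal.IsPrime.ne_top' (zero_mem _)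
    have hf : Ideal.span (Set.range f) = ⊥ := by simp
    rw [hf, ← Ideal.zero_eq_bot, zero_pow (Nat.succ_ne_zero j), Ideal.zero_eq_bot] at hz ⊢
    exact (mul_eq_zero.mp hz).resolve_left hy
  | succ n ih =>
    intro R _ _ y f h j
    have hreg := quotient_of_isIndependentModSq h
    set J := Ideal.span (Set.range fun i : Fin n => f i.succ) with hJ
    have hspan := Ideal.span_range_fin_succ f
    rw [← hJ] at hspan
    rw [hspan]
    have h1 (j : ℕ) {z : R} (hz : f 0 * z ∈ J ^ j) : z ∈ J ^ j := ih h.head j hz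
    have h2 (j : ℕ) {z : R} (hz : y * z ∈ J ^ j ⊔ Ideal.span {f 0}) :
        z ∈ J ^ j ⊔ Ideal.span {f 0} := by
      rw [← mem_map_mk_iff, Ideal.map_pow, hJ, map_mk_span_range] at hz ⊢
      rw [map_mul] at hz
      exact ih h.quotient j hz
    induction j with
    | zero => simp
    | succ j ihj =>
      intro z hz
      obtain ⟨u, hu, v, hv, huv⟩ := Ideal.exists_eq_of_mem_sup_pow_succ _ _ _ hz
      have h3 : z ∈ J ^ (j + 1) ⊔ Ideal.span {f 0} := by
        apply h2
        rw [huv, add_comm (f 0 * u)]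
        exact Submodule.add_mem_sup hv
          (Ideal.mul_mem_right _ _ (Ideal.mem_span_singleton_self _))
      obtain ⟨z₁, hz₁, w, hw, rfl⟩ := Submodule.mem_sup.mp h3
      obtain ⟨z₂, rfl⟩ := Ideal.mem_span_singleton'.mp hw
      have h4 : y * z₂ - u ∈ J ^ (j + 1) := by
        apply h1
        have : f 0 * (y * z₂ - u) = v - y * z₁ := by linear_combination huv
        rw [this]
        exact sub_mem hv (Ideal.mul_mem_left _ _ hz₁)
      have h5 : J ^ (j + 1) ≤ (Ideal.span {f 0} ⊔ J) ^ j :=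
        (Ideal.pow_le_pow_right (Nat.le_succ j)).trans (Ideal.pow_right_mono le_sup_right j)
      have h6 : z₂ ∈ (Ideal.span {f 0} ⊔ J) ^ j := by
        apply ihj
        have := add_mem (h5 h4) hu
        rwa [sub_add_cancel] at this
      refine add_mem (Ideal.pow_right_mono le_sup_right _ hz₁) ?_
      rw [pow_succ]
      exact Ideal.mul_mem_mul h6 (Ideal.mem_sup_left (Ideal.mem_span_singleton_self _))

theorem mem_pow_of_mul_mem {R : Type*} [CommRing R] [IsRegularLocalRing R] {y : R}
    (hy : y ∈ maximalIdeal R) (hy2 : y ∉ maximalIdeal R ^ 2) {k : ℕ} {z : R}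
    (hz : y * z ∈ maximalIdeal R ^ (k + 1)) : z ∈ maximalIdeal R ^ k := by
  obtain ⟨n, f, hf, hspan, -⟩ := exists_isIndependentModSq hy hy2
  have hle : Ideal.span (Set.range f) ≤ maximalIdeal R := hspan ▸ le_sup_right
  rw [← hspan] at hz
  obtain ⟨u, hu, v, hv, huv⟩ := Ideal.exists_eq_of_mem_sup_pow_succ _ _ _ hz
  rw [hspan] at hu
  have := mem_pow_span_of_mul_mem n hf (k + 1) (z := z - u) (by
    rwa [mul_sub, huv, add_sub_cancel_left])
  have := add_mem (Ideal.pow_le_pow_right (Nat.le_succ k) (Ideal.pow_right_mono hle _ this)) hu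
  rwa [sub_add_cancel] at this

theorem mem_pow_sup_span_of_mul_mem (n : ℕ) : ∀ {R : Type*} [CommRing R] [IsRegularLocalRing R]
    {y : R} {f : Fin n → R}, IsIndependentModSq (maximalIdeal R) y f → ∀ {k : ℕ} {z : R},
    y * z ∈ maximalIdeal R ^ (k + 1) ⊔ Ideal.span (Set.range f) →
      z ∈ maximalIdeal R ^ k ⊔ Ideal.span (Set.range f) := by
  induction n with
  | zero =>
    intro R _ _ y f h k z hz
    rw [Set.range_eq_empty, Ideal.span_empty, sup_bot_eq] at hz ⊢
    exact mem_pow_of_mul_mem h.mem (h.notMem_sq Ideal.IsPrime.ne_top') hz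
  | succ n ih =>
    intro R _ _ y f h k z hz
    have hreg := quotient_of_isIndependentModSq h
    rw [Ideal.span_range_fin_succ, sup_comm (Ideal.span {f 0}), ← sup_assoc, ← mem_map_mk_iff,
      Ideal.map_sup, map_mk_span_range, Ideal.map_pow,
      map_maximalIdeal_of_surjective _ Ideal.Quotient.mk_surjective] at hz ⊢
    rw [map_mul] at hz
    exact ih h.quotient hz

end IsRegularLocalRing

theorem IsIndependentModSq.localization {P ι : Type*} [CommRing P] [Fintype ι] {p : Ideal P}
    [p.IsPrime] {y : P} {f : ι → P} (h : IsIndependentModSq p y f) :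
    IsIndependentModSq (maximalIdeal (Localization.AtPrime p)) (algebraMap P _ y)
      fun i => algebraMap P (Localization.AtPrime p) (f i) := by
  have hmem (x : P) : algebraMap P (Localization.AtPrime p) x ∈
      maximalIdeal (Localization.AtPrime p) ↔ x ∈ p :=
    IsLocalization.AtPrime.to_map_mem_maximal_iff _ p x
  refine ⟨(hmem _).mpr h.mem, fun i => (hmem _).mpr (h.mem_right i), fun a b hab => ?_⟩
  classical
  obtain ⟨u, hu⟩ := IsLocalization.exist_integer_multiples p.primeCompl Finset.univ
    (fun o : Option ι => o.elim a b)
  choose c hc using fun o => hu o (Finset.mem_univ o)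
  have hunit := IsLocalization.map_units (Localization.AtPrime p) u
  have hcl (o) : algebraMap P (Localization.AtPrime p) (c o) ∈ maximalIdeal _ →
      o.elim a b ∈ maximalIdeal (Localization.AtPrime p) := fun ho => by
    rw [hc, Algebra.smul_def] at ho
    exact (Ideal.unit_mul_mem_iff_mem _ hunit).mp ho
  have h1 : algebraMap P (Localization.AtPrime p) (c none * y + ∑ i, c (some i) * f i) ∈
      (p ^ 2).map (algebraMap P _) := by
    rw [Ideal.map_pow, Localization.AtPrime.map_eq_maximalIdeal]
    simp only [map_add, map_mul, map_sum, hc, Algebra.smul_def, Option.elim]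
    have := Ideal.mul_mem_left _ (algebraMap P _ (u : P)) hab
    rw [mul_add, Finset.mul_sum] at this
    simpa only [mul_assoc] using this
  obtain ⟨w, hw, hw'⟩ := (IsLocalization.algebraMap_mem_map_algebraMap_iff p.primeCompl _ _ _).mp h1
  have h2 := h.coeff_mem (w * c none) (fun i => w * c (some i)) (by
    convert hw' using 1
    rw [mul_add, Finset.mul_sum]
    simp only [mul_assoc])
  have hcan {x : P} (hx : w * x ∈ p) : x ∈ p := (Ideal.IsPrime.mem_or_mem ‹_› hx).resolve_left hw
  exact ⟨hcl none ((hmem _).mpr (hcan h2.1)), fun i => hcl (some i) ((hmem _).mpr (hcan (h2.2 i)))⟩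

theorem IsRegularRing.exists_mul_mem_of_mul_mem {P : Type*} [CommRing P] [IsRegularRing P]
    {p : Ideal P} [p.IsPrime] {n : ℕ} {y : P} {f : Fin n → P} (h : IsIndependentModSq p y f)
    {k : ℕ} {z : P} (hz : y * z ∈ p ^ (k + 1) ⊔ Ideal.span (Set.range f)) :
    ∃ u ∉ p, u * z ∈ p ^ k ⊔ Ideal.span (Set.range f) := by
  have hmap (j : ℕ) : (p ^ j ⊔ Ideal.span (Set.range f)).map
      (algebraMap P (Localization.AtPrime p)) = maximalIdeal (Localization.AtPrime p) ^ j ⊔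
        Ideal.span (Set.range fun i => algebraMap P (Localization.AtPrime p) (f i)) := by
    rw [Ideal.map_sup, Ideal.map_pow, Localization.AtPrime.map_eq_maximalIdeal, Ideal.map_span,
      ← Set.range_comp]
    rfl
  have h1 := Ideal.mem_map_of_mem (algebraMap P (Localization.AtPrime p)) hz
  rw [hmap, map_mul] at h1
  have := IsRegularRing.isRegularLocalRing_localization p
  have h2 := IsRegularLocalRing.mem_pow_sup_span_of_mul_mem n h.localization h1
  rw [← hmap, IsLocalization.algebraMap_mem_map_algebraMap_iff p.primeCompl] at h2
  exact h2

namespace MvPolynomial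

variable {ι : Type*} (R : Type*) [CommRing R]

/-- The inclusion of the polynomials in the variables of the finite set `t`. -/
noncomputable def finsetInclusion (t : Finset ι) : MvPolynomial t R →+* MvPolynomial ι R :=
  (rename (Subtype.val : t → ι) : MvPolynomial t R →ₐ[R] MvPolynomial ι R).toRingHom

theorem finsetInclusion_injective (t : Finset ι) : Function.Injective (finsetInclusion R t) :=
  rename_injective _ Subtype.val_injective

variable {R}

theorem exists_finset_forall_mem_range (w : MvPolynomial ι R) :
    ∃ s : Finset ι, ∀ t, s ⊆ t → ∃ w', finsetInclusion R t w' = w := by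
  obtain ⟨s, q, rfl⟩ := exists_finset_rename w
  exact ⟨s, fun t hst => ⟨rename (Set.inclusion hst) q, rename_rename _ _ _⟩⟩

theorem exists_finset_forall_mem_comap_pow (q : Ideal (MvPolynomial ι R)) (k : ℕ) :
    ∀ w ∈ q ^ k, ∃ s : Finset ι, ∀ t, s ⊆ t →
      ∃ w' ∈ q.comap (finsetInclusion R t) ^ k, finsetInclusion R t w' = w := by
  classical
  induction k with
  | zero =>
    intro w _
    simpa using exists_finset_forall_mem_range w
  | succ k ih =>
    intro w hw
    rw [pow_succ] at hw
    refine Submodule.mul_induction_on hw (fun a ha b hb => ?_) (fun a b ha hb => ?_)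
    · obtain ⟨s₁, h₁⟩ := ih a ha
      obtain ⟨s₂, h₂⟩ := exists_finset_forall_mem_range b
      refine ⟨s₁ ∪ s₂, fun t ht => ?_⟩
      obtain ⟨a', ha', rfl⟩ := h₁ t (Finset.union_subset_left ht)
      obtain ⟨b', rfl⟩ := h₂ t (Finset.union_subset_right ht)
      exact ⟨a' * b', Ideal.mul_mem_mul ha' hb, map_mul _ _ _⟩
    · obtain ⟨s₁, h₁⟩ := ha
      obtain ⟨s₂, h₂⟩ := hb
      refine ⟨s₁ ∪ s₂, fun t ht => ?_⟩
      obtain ⟨a', ha', rfl⟩ := h₁ t (Finset.union_subset_left ht)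
      obtain ⟨b', hb', rfl⟩ := h₂ t (Finset.union_subset_right ht)
      exact ⟨a' + b', add_mem ha' hb', map_add _ _ _⟩

theorem mem_pow_sup_span_of_mul_mem [IsRegularRing R] {q : Ideal (MvPolynomial ι R)} [q.IsMaximal]
    {n : ℕ} {y : MvPolynomial ι R} {f : Fin n → MvPolynomial ι R} (h : IsIndependentModSq q y f)
    {k : ℕ} {z : MvPolynomial ι R} (hz : y * z ∈ q ^ (k + 1) ⊔ Ideal.span (Set.range f)) :
    z ∈ q ^ k ⊔ Ideal.span (Set.range f) := by
  classical
  obtain ⟨w, hw, v, hv, hwv⟩ := Submodule.mem_sup.mp hz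
  obtain ⟨c, rfl⟩ := (Ideal.mem_span_range_iff_exists_fun).mp hv
  obtain ⟨sy, hsy⟩ := exists_finset_forall_mem_range y
  obtain ⟨sz, hsz⟩ := exists_finset_forall_mem_range z
  obtain ⟨sw, hsw⟩ := exists_finset_forall_mem_comap_pow q (k + 1) w hw
  choose sf hsf using fun i => exists_finset_forall_mem_range (f i)
  choose sc hsc using fun i => exists_finset_forall_mem_range (c i)
  let t := sy ∪ sz ∪ sw ∪ Finset.univ.biUnion sf ∪ Finset.univ.biUnion sc
  obtain ⟨y', hy⟩ := hsy t (by intro x; simp +contextual [t])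
  obtain ⟨z', hz'⟩ := hsz t (by intro x; simp +contextual [t])
  obtain ⟨w', hw', hww⟩ := hsw t (by intro x; simp +contextual [t])
  choose f' hf using fun i => hsf i t (fun x hx => by
    simp only [t, Finset.mem_union, Finset.mem_biUnion]; exact Or.inl (Or.inr ⟨i, by simp, hx⟩))
  choose c' hc using fun i => hsc i t (fun x hx => by
    simp only [t, Finset.mem_union, Finset.mem_biUnion]; exact Or.inr ⟨i, by simp, hx⟩)
  set φ := finsetInclusion R t
  set p := q.comap φ
  have hpow (j : ℕ) : (p ^ j).map φ ≤ q ^ j := by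
    rw [Ideal.map_pow]
    exact Ideal.pow_right_mono Ideal.map_comap_le j
  have hind : IsIndependentModSq p y' f' := by
    refine ⟨?_, fun i => ?_, fun a b hab => ?_⟩
    · rw [Ideal.mem_comap, hy]
      exact h.mem
    · rw [Ideal.mem_comap, hf]
      exact h.mem_right i
    · refine h.coeff_mem (φ a) (fun i => φ (b i)) ?_
      have := hpow 2 (Ideal.mem_map_of_mem φ hab)
      simpa [hy, hf] using this
  have hp : p.IsPrime := inferInstance
  obtain ⟨u, hu, huz⟩ := IsRegularRing.exists_mul_mem_of_mul_mem hind (k := k) (z := z') (by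
    have : y' * z' = w' + ∑ i, c' i * f' i := by
      apply finsetInclusion_injective R t
      change φ _ = φ _
      simp only [map_mul, map_add, map_sum, hy, hz', hww, hf, hc, hwv]
    rw [this]
    exact Submodule.add_mem_sup hw' (Ideal.mem_span_range_iff_exists_fun.mpr ⟨c', rfl⟩))
  have huz' : φ u * z ∈ q ^ k ⊔ Ideal.span (Set.range f) := by
    have := Ideal.mem_map_of_mem φ huz
    rw [Ideal.map_sup, Ideal.map_span, ← Set.range_comp, map_mul, hz'] at this
    refine sup_le_sup (hpow k) (le_of_eq ?_) this
    congr 2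
    ext i
    exact congrArg _ (hf i)
  have hcop : IsCoprime (Ideal.span {φ u}) (q ^ k) := by
    apply IsCoprime.pow_right
    rw [Ideal.isCoprime_iff_sup_eq, sup_comm]
    have hm : q.IsMaximal := inferInstance
    apply hm.out.2
    rw [left_lt_sup]
    exact fun hle => hu (hle (Ideal.mem_span_singleton_self _))
  obtain ⟨a, ha, b, hb, hab⟩ := Ideal.isCoprime_iff_exists.mp hcop
  obtain ⟨a, rfl⟩ := Ideal.mem_span_singleton'.mp ha
  have : z = a * (φ u * z) + z * b := by linear_combination -z * hab
  rw [this]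
  exact add_mem (Ideal.mul_mem_left _ _ huz')
    (Ideal.mem_sup_left (Ideal.mul_mem_left _ _ hb))

end MvPolynomial

theorem Ideal.IsMaximal.mem_of_mul_mem_of_sq_le {P : Type*} [CommRing P] {q I : Ideal P}
    (hq : q.IsMaximal) (hI : q ^ 2 ≤ I) {a u : P} (ha : a ∉ q) (hu : u ∈ q) (h : a * u ∈ I) :
    u ∈ I := by
  obtain ⟨b, c, hc, hbc⟩ := hq.exists_inv ha
  have : u = b * (a * u) + c * u := by linear_combination -u * hbc
  rw [this]
  exact add_mem (I.mul_mem_left _ h) (hI (by rw [pow_two]; exact Ideal.mul_mem_mul hc hu))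

theorem exists_maximal_independent_modSq {P : Type*} [CommRing P] {q : Ideal P} [hqm : q.IsMaximal]
    {y : P} (hy : y ∈ q) (hy2 : y ∉ q ^ 2) {K : Ideal P} (hK : K ≤ q) :
    ∃ s : Set P, s ⊆ K ∧ K ≤ Ideal.span {y} ⊔ Ideal.span s ⊔ q ^ 2 ∧
      ∀ t : Finset P, (t : Set P) ⊆ s → ∀ (a : P) (b : P → P),
        a * y + ∑ u ∈ t, b u * u ∈ q ^ 2 → a ∈ q ∧ ∀ u ∈ t, b u ∈ q := by
  classical
  obtain ⟨s, hs⟩ := zorn_subset {s : Set P | s ⊆ K ∧ ∀ t : Finset P, (t : Set P) ⊆ s →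
      ∀ (a : P) (b : P → P), a * y + ∑ u ∈ t, b u * u ∈ q ^ 2 → a ∈ q ∧ ∀ u ∈ t, b u ∈ q} (by
    intro c hc hchain
    refine ⟨⋃₀ c, ⟨Set.sUnion_subset fun s hs => (hc hs).1, fun t ht => ?_⟩,
      fun s hs => Set.subset_sUnion_of_mem hs⟩
    rcases t.eq_empty_or_nonempty with rfl | hne
    · intro a b hab
      simp only [Finset.sum_empty, add_zero] at hab
      refine ⟨?_, by simp⟩
      by_contra ha
      exact hy2 (hqm.mem_of_mul_mem_of_sq_le le_rfl ha hy hab)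
    · have hcne : c.Nonempty := by
        obtain ⟨u, hu⟩ := hne
        obtain ⟨s, hs, -⟩ := ht hu
        exact ⟨s, hs⟩
      obtain ⟨s, hs, hts⟩ := DirectedOn.exists_mem_subset_of_finset_subset_biUnion hcne
        (f := id) hchain.directedOn (s := t) (by simpa [Set.sUnion_eq_biUnion] using ht)
      exact (hc hs).2 t hts)
  refine ⟨s, hs.prop.1, fun k hk => ?_, hs.prop.2⟩
  by_contra hks
  set I := Ideal.span {y} ⊔ Ideal.span s ⊔ q ^ 2
  have hsI : s ⊆ I := fun u hu => Ideal.mem_sup_left (Ideal.mem_sup_right (Ideal.subset_span hu))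
  have hyI : y ∈ I := Ideal.mem_sup_left (Ideal.mem_sup_left (Ideal.mem_span_singleton_self y))
  have hqI : q ^ 2 ≤ I := le_sup_right
  have hins : insert k s ⊆ s := hs.le_of_ge ⟨Set.insert_subset hk hs.prop.1, fun t ht a b hab => by
    have hte : ((t.erase k : Finset P) : Set P) ⊆ s := by
      intro u hu
      rw [Finset.mem_coe, Finset.mem_erase] at hu
      exact (ht hu.2).resolve_left hu.1
    by_cases hkt : k ∈ t
    · rw [← Finset.add_sum_erase t _ hkt] at hab
      have hbk : b k ∈ q := by
        by_contra hbk
        refine hks (hqm.mem_of_mul_mem_of_sq_le hqI hbk (hK hk) ?_)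
        have : b k * k = (a * y + (b k * k + ∑ u ∈ t.erase k, b u * u)) - a * y -
          ∑ u ∈ t.erase k, b u * u := by ring
        rw [this]
        exact sub_mem (sub_mem (hqI hab) (I.mul_mem_left _ hyI))
          (sum_mem fun u hu => I.mul_mem_left _ (hsI (hte hu)))
      have h1 := hs.prop.2 _ hte a b (by
        have : a * y + ∑ u ∈ t.erase k, b u * u =
          (a * y + (b k * k + ∑ u ∈ t.erase k, b u * u)) - b k * k := by ring
        rw [this]
        exact sub_mem hab (by rw [pow_two]; exact Ideal.mul_mem_mul hbk (hK hk)))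
      refine ⟨h1.1, fun u hu => ?_⟩
      by_cases huk : u = k
      · rwa [huk]
      · exact h1.2 u (Finset.mem_erase.mpr ⟨huk, hu⟩)
    · rw [Finset.erase_eq_of_notMem hkt] at hte
      exact hs.prop.2 t hte a b hab⟩ (Set.subset_insert k s)
  exact hks (hsI (hins (Set.mem_insert k s)))

theorem MvPolynomial.exists_le_forall_mem_pow_sup_of_mul_mem {ι R : Type*} [CommRing R]
    [IsRegularRing R] {q : Ideal (MvPolynomial ι R)} [q.IsMaximal] {y : MvPolynomial ι R}
    (hy : y ∈ q) (hy2 : y ∉ q ^ 2) {K : Ideal (MvPolynomial ι R)} (hK : K ≤ q) :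
    ∃ J ≤ K, K ≤ Ideal.span {y} ⊔ J ⊔ q ^ 2 ∧
      ∀ k z, y * z ∈ q ^ (k + 1) ⊔ J → z ∈ q ^ k ⊔ J := by
  obtain ⟨s, hsK, hKs, hs⟩ := exists_maximal_independent_modSq hy hy2 hK
  refine ⟨Ideal.span s, Ideal.span_le.mpr hsK, hKs, fun k z hz => ?_⟩
  obtain ⟨w, hw, v, hv, hwv⟩ := Submodule.mem_sup.mp hz
  obtain ⟨t, hts, hvt⟩ := Submodule.mem_span_finite_of_mem_span hv
  let f : Fin t.card → MvPolynomial ι R := fun i => t.equivFin.symm i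
  have hrange : Set.range f = t := by
    ext u
    refine ⟨?_, fun hu => ⟨t.equivFin ⟨u, hu⟩, by simp [f]⟩⟩
    rintro ⟨i, rfl⟩
    exact (t.equivFin.symm i).2
  have hind : IsIndependentModSq q y f := by
    refine ⟨hy, fun i => hK (hsK (hts (t.equivFin.symm i).2)), fun a b hab => ?_⟩
    classical
    let b' (u) := if hu : u ∈ t then b (t.equivFin ⟨u, hu⟩) else 0
    have hb' (i) : b' (f i) = b i := by
      simp [b', f]
    have h1 := hs t hts a b' (by
      convert hab using 2
      rw [← Finset.sum_coe_sort t (fun u => b' u * u), ← t.equivFin.symm.sum_comp]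
      exact Finset.sum_congr rfl fun i _ => by rw [← hb' i])
    exact ⟨h1.1, fun i => hb' i ▸ h1.2 _ (t.equivFin.symm i).2⟩
  have h1 := MvPolynomial.mem_pow_sup_span_of_mul_mem hind (k := k) (z := z) (by
    rw [hrange, ← hwv]
    exact Submodule.add_mem_sup hw hvt)
  rw [hrange] at h1
  exact SetLike.le_def.mp (sup_le_sup_left (Ideal.span_mono hts) _) h1

namespace AdicCompletion

variable {D : Type*} [CommRing D] (m : Ideal D)

theorem exists_forall_evalₐ_eq (f : ℕ → D) (hf : ∀ n, f (n + 1) - f n ∈ m ^ n) :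
    ∃ L : AdicCompletion m D, ∀ n, evalₐ m n L = Ideal.Quotient.mk _ (f n) := by
  refine ⟨AdicCompletion.mk m D (AdicCauchySequence.mk m D f fun n => ?_), fun n => ?_⟩
  · rw [SModEq.sub_mem, ← neg_mem_iff, neg_sub]
    simpa using hf n
  · exact evalₐ_mk m n _

theorem exists_evalₐ_eq (t : AdicCompletion m D) : ∃ f : ℕ → D, (∀ n, f (n + 1) - f n ∈ m ^ n) ∧
    ∀ n, evalₐ m n t = Ideal.Quotient.mk _ (f n) := by
  obtain ⟨f, rfl⟩ := mk_surjective m D t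
  refine ⟨f, fun n => ?_, fun n => evalₐ_mk m n f⟩
  rw [← neg_mem_iff, neg_sub]
  have := f.2 n.le_succ
  rw [SModEq.sub_mem] at this
  simpa using this

theorem evalₐ_eq_mk_of_le {k n : ℕ} (hkn : k ≤ n) {t : AdicCompletion m D} {d : D}
    (h : evalₐ m n t = Ideal.Quotient.mk _ d) : evalₐ m k t = Ideal.Quotient.mk _ d := by
  obtain ⟨f, hf, hft⟩ := exists_evalₐ_eq m t
  have hcauchy : ∀ j, f (k + j) - f k ∈ m ^ k := by
    intro j
    induction j with
    | zero => simp
    | succ j ih =>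
      have := Ideal.pow_le_pow_right (Nat.le_add_right k j) (hf (k + j))
      convert add_mem ih this using 1
      rw [← add_assoc]
      ring
  rw [hft, Ideal.Quotient.eq] at h ⊢
  have h1 := hcauchy (n - k)
  rw [Nat.add_sub_cancel' hkn] at h1
  have h2 := Ideal.pow_le_pow_right hkn h
  convert sub_mem h2 h1 using 1
  ring

variable {m} {n : ℕ} {g : Fin n → D}

theorem pow_add_le (hg : ∀ i, g i ∈ m) (hm : m ≤ Ideal.span (Set.range g) ⊔ m ^ 2) (k j : ℕ) :
    m ^ (j + k) ≤ m ^ j * Ideal.span (Set.range g) ^ k ⊔ m ^ (j + k + 1) := by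
  set G := Ideal.span (Set.range g)
  have hGm : G ≤ m := Ideal.span_le.mpr (by rintro _ ⟨i, rfl⟩; exact hg i)
  induction k with
  | zero => simp
  | succ k ih =>
    calc m ^ (j + (k + 1)) = m ^ (j + k) * m := by rw [← add_assoc, pow_succ]
      _ ≤ (m ^ j * G ^ k ⊔ m ^ (j + k + 1)) * (G ⊔ m ^ 2) := Ideal.mul_mono ih hm
      _ ≤ _ := by
        rw [Ideal.sup_mul, Ideal.mul_sup, Ideal.mul_sup]
        refine sup_le (sup_le ?_ ?_) (sup_le ?_ ?_)
        · rw [mul_assoc, ← pow_succ]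
          exact le_sup_left
        · refine le_sup_of_le_right ?_
          calc m ^ j * G ^ k * m ^ 2 ≤ m ^ j * m ^ k * m ^ 2 := by gcongr
            _ = _ := by ring
        · refine le_sup_of_le_right ?_
          calc m ^ (j + k + 1) * G ≤ m ^ (j + k + 1) * m := by gcongr
            _ = _ := by ring
        · refine le_sup_of_le_right ?_
          rw [← pow_add]
          exact Ideal.pow_le_pow_right (by omega)

theorem map_pow_le_ker_evalₐ {G : Ideal D} (hGm : G ≤ m) (k : ℕ) :
    G.map (algebraMap D (AdicCompletion m D)) ^ k ≤ RingHom.ker (evalₐ m k) := by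
  rw [← Ideal.map_pow, Ideal.map_le_iff_le_comap]
  intro d hd
  rw [Ideal.mem_comap, RingHom.mem_ker, AlgHom.commutes]
  exact Ideal.Quotient.eq_zero_iff_mem.mpr (Ideal.pow_right_mono hGm k hd)

theorem ker_evalₐ_eq_map_pow (hg : ∀ i, g i ∈ m) (hm : m ≤ Ideal.span (Set.range g) ⊔ m ^ 2)
    (k : ℕ) : RingHom.ker (evalₐ m k) =
      (Ideal.span (Set.range g)).map (algebraMap D (AdicCompletion m D)) ^ k := by
  set G := Ideal.span (Set.range g) with hG
  have hGm : G ≤ m := Ideal.span_le.mpr (by rintro _ ⟨i, rfl⟩; exact hg i)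
  refine le_antisymm (fun t ht => ?_) (map_pow_le_ker_evalₐ hGm k)
  obtain ⟨r, h, hh⟩ := Submodule.fg_iff_exists_fin_generating_family.mp
    (Submodule.FG.pow (Submodule.fg_span (Set.finite_range g) : G.FG) k)
  have hstep (j : ℕ) (d : D) (hd : d ∈ m ^ (j + k)) :
      ∃ a : Fin r → D, (∀ i, a i ∈ m ^ j) ∧ d - ∑ i, a i * h i ∈ m ^ (j + 1 + k) := by
    obtain ⟨u, hu, v, hv, huv⟩ := Submodule.mem_sup.mp (pow_add_le hg hm k j hd)
    rw [← hG, ← hh, ← smul_eq_mul, Submodule.mem_ideal_smul_span_iff_exists_sum] at hu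
    obtain ⟨a, ha, rfl⟩ := hu
    refine ⟨a, ha, ?_⟩
    rw [Finsupp.sum_fintype _ _ (by simp)] at huv
    simp only [smul_eq_mul] at huv
    rw [← huv, add_sub_cancel_left, Nat.add_right_comm]
    exact hv
  choose! a ha had using hstep
  obtain ⟨f, hf, hft⟩ := exists_evalₐ_eq m t
  let b (N : ℕ) : Fin r → D := Nat.rec 0
    (fun j c => c + a j (f (j + 1 + k) - ∑ i, c i * h i)) N
  have hb (j) : b (j + 1) = b j + a j (f (j + 1 + k) - ∑ i, b j i * h i) := rfl
  have hnext (j) (hj : f (j + k) - ∑ i, b j i * h i ∈ m ^ (j + k)) :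
      f (j + 1 + k) - ∑ i, b j i * h i ∈ m ^ (j + k) := by
    have h2 := hf (j + k)
    rw [Nat.add_right_comm] at h2
    convert add_mem h2 hj using 1
    ring
  have hmem (j) : f (j + k) - ∑ i, b j i * h i ∈ m ^ (j + k) := by
    induction j with
    | zero =>
      have : evalₐ m k t = 0 := ht
      rw [hft, Ideal.Quotient.eq_zero_iff_mem] at this
      simpa [b] using this
    | succ j ih =>
      convert had j _ (hnext j ih) using 1
      simp only [hb, Pi.add_apply, add_mul, Finset.sum_add_distrib]
      ring
  choose L hL using fun i => exists_forall_evalₐ_eq m (fun j => b j i) (fun j => by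
    simpa [hb] using ha j _ (hnext j (hmem j)) i)
  have htL : t = ∑ i, L i * algebraMap D _ (h i) := by
    refine ext_evalₐ fun j => ?_
    rw [evalₐ_eq_mk_of_le m (Nat.le_add_right j k) (hft (j + k)), map_sum]
    simp only [map_mul, hL, AlgHom.commutes]
    change _ = ∑ i, Ideal.Quotient.mk (m ^ j) (b j i) * Ideal.Quotient.mk (m ^ j) (h i)
    simp only [← map_mul, ← map_sum]
    rw [Ideal.Quotient.eq]
    exact Ideal.pow_le_pow_right (Nat.le_add_right j k) (hmem j)
  rw [htL, ← Ideal.map_pow]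
  refine sum_mem fun i _ => Ideal.mul_mem_left _ _ (Ideal.mem_map_of_mem _ ?_)
  rw [← hh]
  exact Submodule.subset_span ⟨i, rfl⟩

theorem isAdicComplete_map_of_le_sup_sq (hg : ∀ i, g i ∈ m)
    (hm : m ≤ Ideal.span (Set.range g) ⊔ m ^ 2) :
    IsAdicComplete ((Ideal.span (Set.range g)).map (algebraMap D (AdicCompletion m D)))
      (AdicCompletion m D) := by
  have hker := ker_evalₐ_eq_map_pow hg hm
  set I := (Ideal.span (Set.range g)).map (algebraMap D (AdicCompletion m D))
  refine { haus' := fun t ht => ?_, prec' := fun s hs => ?_ }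
  · refine ext_evalₐ fun k => ?_
    have := ht k
    rw [SModEq.zero, smul_eq_mul, Ideal.mul_top, ← hker] at this
    exact RingHom.mem_ker.mp this |>.trans (_root_.map_zero _).symm
  · have hs' (n) : evalₐ m n (s n) = evalₐ m n (s (n + 1)) := by
      have := hs n.le_succ
      rw [SModEq.sub_mem, smul_eq_mul, Ideal.mul_top, ← hker, RingHom.mem_ker, map_sub,
        sub_eq_zero] at this
      exact this
    choose d hd using fun n => Ideal.Quotient.mk_surjective (evalₐ m n (s n))
    obtain ⟨L, hL⟩ := exists_forall_evalₐ_eq m d fun n => by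
      have h1 := evalₐ_eq_mk_of_le m n.le_succ (hd (n + 1)).symm
      rw [← hs', ← hd, Ideal.Quotient.eq, ← neg_mem_iff, neg_sub] at h1
      exact h1
    refine ⟨L, fun n => ?_⟩
    rw [SModEq.sub_mem, smul_eq_mul, Ideal.mul_top, ← hker, RingHom.mem_ker, map_sub, hL, hd,
      sub_self]

theorem isMaximal_map_of_le_sup_sq [hmm : m.IsMaximal] (hg : ∀ i, g i ∈ m)
    (hm : m ≤ Ideal.span (Set.range g) ⊔ m ^ 2) :
    ((Ideal.span (Set.range g)).map (algebraMap D (AdicCompletion m D))).IsMaximal := by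
  have hker := ker_evalₐ_eq_map_pow hg hm 1
  rw [pow_one (Ideal.map _ _)] at hker
  rw [← hker]
  have : (m ^ 1).IsMaximal := by rwa [pow_one]
  let := Ideal.Quotient.field (m ^ 1)
  exact RingHom.ker_isMaximal_of_surjective _ (surjective_evalₐ m 1)

theorem isNoetherianRing_of_le_sup_sq [m.IsMaximal] (hg : ∀ i, g i ∈ m)
    (hm : m ≤ Ideal.span (Set.range g) ⊔ m ^ 2) : IsNoetherianRing (AdicCompletion m D) := by
  have h1 := isAdicComplete_map_of_le_sup_sq hg hm
  have h2 := isMaximal_map_of_le_sup_sq hg hm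
  have h3 : (Ideal.span (Set.range g)).map (algebraMap D (AdicCompletion m D)) =
      Ideal.span (Set.range fun i => algebraMap D (AdicCompletion m D) (g i)) := by
    rw [Ideal.map_span, ← Set.range_comp]
    rfl
  rw [h3] at h1 h2
  let := Ideal.Quotient.field
    (Ideal.span (Set.range fun i => algebraMap D (AdicCompletion m D) (g i)))
  exact isNoetherianRing_of_isAdicComplete fun i => algebraMap D (AdicCompletion m D) (g i)

theorem isLocalRing_of_le_sup_sq [m.IsMaximal] (hg : ∀ i, g i ∈ m)
    (hm : m ≤ Ideal.span (Set.range g) ⊔ m ^ 2) : IsLocalRing (AdicCompletion m D) :=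
  have := isAdicComplete_map_of_le_sup_sq hg hm
  have := isMaximal_map_of_le_sup_sq hg hm
  isLocalRing_of_isAdicComplete_maximal
    ((Ideal.span (Set.range g)).map (algebraMap D (AdicCompletion m D)))

theorem algebraMap_mem_nonZeroDivisors {y : D} (hy : ∀ k z, y * z ∈ m ^ (k + 1) → z ∈ m ^ k) :
    algebraMap D (AdicCompletion m D) y ∈ nonZeroDivisors (AdicCompletion m D) := by
  rw [mem_nonZeroDivisors_iff_right]
  intro t ht
  refine ext_evalₐ fun k => ?_
  obtain ⟨d, hd⟩ := Ideal.Quotient.mk_surjective (evalₐ m (k + 1) t)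
  rw [evalₐ_eq_mk_of_le m k.le_succ hd.symm, _root_.map_zero, Ideal.Quotient.eq_zero_iff_mem]
  apply hy
  have := congrArg (evalₐ m (k + 1)) ht
  rw [map_mul, ← hd, AlgHom.commutes, _root_.map_zero, mul_comm] at this
  exact Ideal.Quotient.eq_zero_iff_mem.mp this

variable (m) in
theorem exists_ringHom_extending {A : Type*} [CommRing A] (I : Ideal A) [IsAdicComplete I A]
    (α : D →+* A) (h : m ≤ I.comap α) : ∃ α' : AdicCompletion m D →+* A,
      (∀ d, α' (algebraMap D _ d) = α d) ∧
        ∀ k t d, evalₐ m k t = Ideal.Quotient.mk _ d → α' t - α d ∈ I ^ k := by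
  have hk (k : ℕ) : m ^ k ≤ (I ^ k).comap α :=
    (Ideal.pow_right_mono h k).trans (Ideal.le_comap_pow α k)
  let f (k : ℕ) : AdicCompletion m D →+* A ⧸ I ^ k :=
    (Ideal.quotientMap (I ^ k) α (hk k)).comp (evalₐ m k).toRingHom
  have hf (k) (t) (d) (h : evalₐ m k t = Ideal.Quotient.mk _ d) :
      f k t = Ideal.Quotient.mk _ (α d) := by
    change Ideal.quotientMap (I ^ k) α (hk k) (evalₐ m k t) = _
    rw [h, Ideal.quotientMap_mk]
  have hfac {j k : ℕ} (hjk : j ≤ k) : (Ideal.Quotient.factorPow I hjk).comp (f k) = f j := by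
    ext t
    obtain ⟨d, hd⟩ := Ideal.Quotient.mk_surjective (evalₐ m k t)
    rw [RingHom.comp_apply, hf k t d hd.symm, hf j t d (evalₐ_eq_mk_of_le m hjk hd.symm)]
    rfl
  have hlift (k t d) (h : evalₐ m k t = Ideal.Quotient.mk _ d) :
      IsAdicComplete.liftRingHom I f hfac t - α d ∈ I ^ k := by
    rw [← Ideal.Quotient.eq, IsAdicComplete.mk_liftRingHom, hf k t d h]
  refine ⟨IsAdicComplete.liftRingHom I f hfac, fun d => ?_, hlift⟩
  rw [← sub_eq_zero]
  exact eq_zero_of_forall_mem_pow I fun k => hlift k _ d (AlgHom.commutes _ _)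

end AdicCompletion

/-- A surjection from a completion `T` of `D`. -/
theorem exists_isLocalRing_of_adic_data {D A S C : Type} [CommRing D] [CommRing A] [CommRing S]
    [CommRing C] [IsLocalRing A] [IsLocalRing S] [IsLocalRing C] [IsNoetherianRing C]
    [IsAdicComplete (maximalIdeal A) A] [IsAdicComplete (maximalIdeal S) S]
    {π : A →+* C} {q : S →+* C} (hπ : Function.Surjective π) (hqs : Function.Surjective q)
    {m : Ideal D} [m.IsMaximal] {α : D →+* A} {β : D →+* S} (hmα : m ≤ (maximalIdeal A).comap α)
    (hmβ : m ≤ (maximalIdeal S).comap β) (hαβ : π.comp α = q.comp β) {n : ℕ} {y : D}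
    {σ : Fin n → D} (hy : y ∈ m) (hσ : ∀ i, σ i ∈ m)
    (hm : m ≤ Ideal.span {y} ⊔ Ideal.span (Set.range σ) ⊔ m ^ 2)
    (hyz : ∀ k z, y * z ∈ m ^ (k + 1) → z ∈ m ^ k) :
    ∃ (T : Type) (_ : CommRing T) (_ : IsLocalRing T) (_ : IsNoetherianRing T) (f : D →+* T)
      (α' : T →+* A) (β' : T →+* S), f y ∈ nonZeroDivisors T ∧
        Ideal.span {f y} ⊔ Ideal.span (Set.range fun i => f (σ i)) = maximalIdeal T ∧
        α'.comp f = α ∧ β'.comp f = β ∧ π.comp α' = q.comp β' := by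
  let g : Fin (n + 1) → D := Fin.cons y σ
  have hg : ∀ i, g i ∈ m := Fin.cases hy hσ
  have hrange : Ideal.span (Set.range g) = Ideal.span {y} ⊔ Ideal.span (Set.range σ) := by
    rw [Fin.range_cons, Set.insert_eq, Ideal.span_union]
  rw [← hrange] at hm
  have hloc := AdicCompletion.isLocalRing_of_le_sup_sq hg hm
  have hmax := AdicCompletion.isMaximal_map_of_le_sup_sq hg hm
  obtain ⟨α', hα', hα''⟩ := AdicCompletion.exists_ringHom_extending m (maximalIdeal A) α hmα
  obtain ⟨β', hβ', hβ''⟩ := AdicCompletion.exists_ringHom_extending m (maximalIdeal S) β hmβ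
  have hlocπ := hπ.isLocalHom π
  have hlocq := hqs.isLocalHom q
  refine ⟨AdicCompletion m D, inferInstance, hloc,
    AdicCompletion.isNoetherianRing_of_le_sup_sq hg hm, algebraMap _ _, α', β',
    AdicCompletion.algebraMap_mem_nonZeroDivisors hyz, ?_, RingHom.ext hα', RingHom.ext hβ', ?_⟩
  · rw [← IsLocalRing.eq_maximalIdeal hmax, hrange, Ideal.map_sup, Ideal.map_span, Ideal.map_span,
      Set.image_singleton, ← Set.range_comp]
    rfl
  · ext t
    have hpow (k : ℕ) : π (α' t) - q (β' t) ∈ maximalIdeal C ^ k := by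
      obtain ⟨d, hd⟩ := Ideal.Quotient.mk_surjective (AdicCompletion.evalₐ m k t)
      have h1 := Ideal.mem_map_of_mem π (hα'' k t d hd.symm)
      have h2 := Ideal.mem_map_of_mem q (hβ'' k t d hd.symm)
      rw [Ideal.map_pow, map_maximalIdeal_of_surjective _ hπ] at h1
      rw [Ideal.map_pow, map_maximalIdeal_of_surjective _ hqs] at h2
      have h3 := RingHom.congr_fun hαβ d
      rw [RingHom.comp_apply, RingHom.comp_apply] at h3
      convert sub_mem h1 h2 using 1
      rw [map_sub, map_sub, h3]
      ring
    exact sub_eq_zero.mp (eq_zero_of_forall_mem_pow (maximalIdeal C) hpow)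

theorem MvPolynomial.X_notMem_sq {B R : Type*} [CommRing R] {q : Ideal (MvPolynomial B R)}
    (hq : q ≠ ⊤) (b : B) : (X b : MvPolynomial B R) ∉ q ^ 2 := by
  intro h
  have key : ∀ w ∈ q ^ 2, pderiv b w ∈ q := by
    intro w hw
    rw [pow_two] at hw
    refine Submodule.mul_induction_on hw (fun u hu v hv => ?_) fun u v hu hv => ?_
    · rw [Derivation.leibniz, smul_eq_mul, smul_eq_mul]
      exact add_mem (q.mul_mem_right _ hu) (q.mul_mem_right _ hv)
    · rw [map_add]
      exact add_mem hu hv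
  have := key _ h
  rw [pderiv_X_self] at this
  exact hq ((Ideal.eq_top_iff_one q).mpr this)

/-- Every commutative ring `B` is the quotient of a ring in which a given nonunit behaves like
a regular parameter. -/
theorem exists_surjective_of_mem_isMaximal {B : Type} [CommRing B] {p : Ideal B} [p.IsMaximal]
    {n : ℕ} {b : B} {σ : Fin n → B} (hp : p = Ideal.span {b} ⊔ Ideal.span (Set.range σ)) :
    ∃ (D : Type) (_ : CommRing D) (φ : D →+* B) (m : Ideal D) (_ : m.IsMaximal) (y : D)
      (τ : Fin n → D), Function.Surjective φ ∧ m ≤ p.comap φ ∧ φ y = b ∧ (∀ i, φ (τ i) = σ i) ∧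
        y ∈ m ∧ (∀ i, τ i ∈ m) ∧ m ≤ Ideal.span {y} ⊔ Ideal.span (Set.range τ) ⊔ m ^ 2 ∧
        ∀ k z, y * z ∈ m ^ (k + 1) → z ∈ m ^ k := by
  let ε : MvPolynomial B ℤ →+* B := MvPolynomial.eval₂Hom (Int.castRingHom B) id
  have hεX (c : B) : ε (MvPolynomial.X c) = c := MvPolynomial.eval₂Hom_X' _ _ c
  have hε : Function.Surjective ε := fun c => ⟨_, hεX c⟩
  have hmax : (p.comap ε).IsMaximal := Ideal.comap_isMaximal_of_surjective ε hε
  have hb : b ∈ p := hp ▸ Ideal.mem_sup_left (Ideal.mem_span_singleton_self b)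
  have hσ (i) : σ i ∈ p := hp ▸ Ideal.mem_sup_right (Ideal.subset_span ⟨i, rfl⟩)
  have hker : RingHom.ker ε ≤ p.comap ε := Ideal.comap_mono bot_le
  obtain ⟨J, hJ, hKJ, hcancel⟩ := MvPolynomial.exists_le_forall_mem_pow_sup_of_mul_mem
    (q := p.comap ε) (y := MvPolynomial.X b) (by rw [Ideal.mem_comap, hεX]; exact hb)
    (MvPolynomial.X_notMem_sq hmax.ne_top b) hker
  set Q := p.comap ε
  let mk := Ideal.Quotient.mk J
  have hmk : Function.Surjective mk := Ideal.Quotient.mk_surjective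
  have hX (c : B) (hc : c ∈ p) : mk (MvPolynomial.X c) ∈ Q.map mk :=
    Ideal.mem_map_of_mem _ (by rw [Ideal.mem_comap, hεX]; exact hc)
  refine ⟨MvPolynomial B ℤ ⧸ J, inferInstance, Ideal.Quotient.lift J ε hJ, Q.map mk,
    Ideal.IsMaximal.map_of_surjective_of_ker_le hmk (by
      rw [Ideal.mk_ker]; exact hJ.trans hker),
    mk (MvPolynomial.X b), fun i => mk (MvPolynomial.X (σ i)),
    Ideal.Quotient.lift_surjective_of_surjective _ _ hε, ?_, hεX b, fun i => hεX (σ i),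
    hX b hb, fun i => hX _ (hσ i), ?_, fun k z hz => ?_⟩
  · rw [Ideal.map_le_iff_le_comap]
    exact le_rfl
  · have h1 : Q ≤ Ideal.span {MvPolynomial.X b} ⊔
        Ideal.span (Set.range fun i => MvPolynomial.X (σ i)) ⊔ RingHom.ker ε := by
      have : Q = Ideal.comap ε (Ideal.map ε (Ideal.span {MvPolynomial.X b} ⊔
          Ideal.span (Set.range fun i => MvPolynomial.X (σ i)))) := by
        rw [Ideal.map_sup, Ideal.map_span, Ideal.map_span, Set.image_singleton, ← Set.range_comp,
          hεX]
        simp only [Function.comp_def, hεX, ← hp, Q]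
      rw [this, Ideal.comap_map_of_surjective _ hε]
      exact le_rfl
    have h2 : Q ≤ Ideal.span {MvPolynomial.X b} ⊔
        Ideal.span (Set.range fun i => MvPolynomial.X (σ i)) ⊔ Q ^ 2 ⊔ J := by
      refine h1.trans (sup_le (le_sup_of_le_left le_sup_left) (hKJ.trans ?_))
      refine sup_le (sup_le ?_ le_sup_right) (le_sup_of_le_left le_sup_right)
      exact le_sup_of_le_left (le_sup_of_le_left le_sup_left)
    refine (Ideal.map_mono h2).trans ?_
    rw [Ideal.map_sup, Ideal.map_sup, Ideal.map_sup, Ideal.map_span, Ideal.map_span,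
      Set.image_singleton, ← Set.range_comp, Ideal.map_quotient_self, sup_bot_eq, Ideal.map_pow]
    exact le_rfl
  · obtain ⟨z, rfl⟩ := hmk z
    rw [← Ideal.map_pow, ← map_mul, Ideal.mem_quotient_iff_mem_sup] at hz
    rw [← Ideal.map_pow, Ideal.mem_quotient_iff_mem_sup]
    exact hcancel k z hz

theorem exists_isLocalRing_over_fiberProduct {A S C : Type} [CommRing A] [CommRing S]
    [CommRing C] [IsLocalRing A] [IsLocalRing S] [IsLocalRing C] [IsNoetherianRing C]
    [IsAdicComplete (maximalIdeal A) A] [IsAdicComplete (maximalIdeal S) S]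
    {π : A →+* C} {q : S →+* C} (hπ : Function.Surjective π) (hq : Function.Surjective q)
    {x : A} (hx : RingHom.ker π = Ideal.span {x}) {n : ℕ} {s : Fin n → S}
    (hs : Ideal.span (Set.range s) = maximalIdeal S) :
    ∃ (T : Type) (_ : CommRing T) (_ : IsLocalRing T) (_ : IsNoetherianRing T) (y : T)
      (σ : Fin n → T) (α : T →+* A) (β : T →+* S), y ∈ nonZeroDivisors T ∧
        Ideal.span {y} ⊔ Ideal.span (Set.range σ) = maximalIdeal T ∧
        Function.Surjective α ∧ Function.Surjective β ∧ α y = x ∧ β y = 0 ∧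
        (∀ i, β (σ i) = s i) ∧ π.comp α = q.comp β := by
  let B := RingHom.eqLocus (π.comp (RingHom.fst A S)) (q.comp (RingHom.snd A S))
  have hB (a : A) (t : S) : (a, t) ∈ B ↔ π a = q t := Iff.rfl
  let α₀ : B →+* A := (RingHom.fst A S).comp B.subtype
  let β₀ : B →+* S := (RingHom.snd A S).comp B.subtype
  have hα₀ : Function.Surjective α₀ := fun a => by
    obtain ⟨t, ht⟩ := hq (π a)
    exact ⟨⟨(a, t), ht.symm⟩, rfl⟩
  have hβ₀ : Function.Surjective β₀ := fun t => by
    obtain ⟨a, ha⟩ := hπ (q t)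
    exact ⟨⟨(a, t), ha⟩, rfl⟩
  have hcomm (c : B) : π (α₀ c) = q (β₀ c) := c.2
  have hπx : π x = 0 := by
    rw [← RingHom.mem_ker, hx]
    exact Ideal.mem_span_singleton_self x
  let b : B := ⟨(x, 0), by rw [hB, hπx, map_zero]⟩
  choose σ₀ hσ₀ using fun i => hβ₀ (s i)
  let p := (maximalIdeal S).comap β₀
  have hpmax : p.IsMaximal := Ideal.comap_isMaximal_of_surjective β₀ hβ₀
  have hp : p = Ideal.span {b} ⊔ Ideal.span (Set.range σ₀) := by
    refine le_antisymm (fun c hc => ?_) (sup_le ?_ ?_)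
    · have hc' : β₀ c ∈ Ideal.span (Set.range s) := hs ▸ hc
      obtain ⟨e, he⟩ := Ideal.mem_span_range_iff_exists_fun.mp hc'
      choose e' he' using fun i => hβ₀ (e i)
      have h1 : β₀ (c - ∑ i, e' i * σ₀ i) = 0 := by
        simp [map_sub, map_sum, hσ₀, he', he]
      have h2 : α₀ (c - ∑ i, e' i * σ₀ i) ∈ RingHom.ker π := by
        rw [RingHom.mem_ker, hcomm, h1, map_zero]
      rw [hx] at h2
      obtain ⟨a, ha⟩ := Ideal.mem_span_singleton'.mp h2
      obtain ⟨a', rfl⟩ := hα₀ a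
      have h3 : c = a' * b + ∑ i, e' i * σ₀ i := by
        rw [← sub_eq_iff_eq_add]
        refine Subtype.ext (Prod.ext ha.symm ?_)
        exact h1.trans (mul_zero (β₀ a')).symm
      rw [h3]
      exact Submodule.add_mem_sup (Ideal.mul_mem_left _ _ (Ideal.mem_span_singleton_self b))
        (Ideal.mem_span_range_iff_exists_fun.mpr ⟨e', rfl⟩)
    · rw [Ideal.span_singleton_le_iff_mem, Ideal.mem_comap]
      exact (maximalIdeal S).zero_mem
    · rw [Ideal.span_le]
      rintro _ ⟨i, rfl⟩
      rw [SetLike.mem_coe, Ideal.mem_comap, hσ₀, ← hs]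
      exact Ideal.subset_span ⟨i, rfl⟩
  have hpα : p ≤ (maximalIdeal A).comap α₀ := by
    intro c hc
    have := hq.isLocalHom q
    rw [Ideal.mem_comap, mem_maximalIdeal, mem_nonunits_iff] at hc ⊢
    intro hu
    have h1 := hu.map π
    rw [hcomm] at h1
    exact hc (isUnit_of_map_unit q _ h1)
  obtain ⟨D, _, φ, m, _, y, τ, hφ, hmp, hyb, hτσ, hy, hτ, hm, hcancel⟩ :=
    exists_surjective_of_mem_isMaximal hp
  obtain ⟨T, _, _, _, f, α, β, hreg, hmax, hα, hβ, hαβ⟩ := exists_isLocalRing_of_adic_data hπ hq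
    (α := α₀.comp φ) (β := β₀.comp φ) (hmp.trans (Ideal.comap_mono hpα)) hmp
    (by ext d; exact hcomm (φ d)) hy hτ hm hcancel
  have hα' (d : D) : α (f d) = α₀ (φ d) := RingHom.congr_fun hα d
  have hβ' (d : D) : β (f d) = β₀ (φ d) := RingHom.congr_fun hβ d
  refine ⟨T, _, ‹_›, ‹_›, f y, fun i => f (τ i), α, β, hreg, hmax, ?_, ?_, ?_, ?_, fun i => ?_, hαβ⟩
  · refine Function.Surjective.of_comp (g := f) ?_
    rw [← RingHom.coe_comp, hα]
    exact hα₀.comp hφ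
  · refine Function.Surjective.of_comp (g := f) ?_
    rw [← RingHom.coe_comp, hβ]
    exact hβ₀.comp hφ
  · rw [hα', hyb]
    rfl
  · rw [hβ', hyb]
    rfl
  · rw [hβ', hτσ, hσ₀]

theorem comap_ofList_le_of_isWeaklyRegular {T S : Type*} [CommRing T] [CommRing S]
    [IsLocalRing T] [IsNoetherianRing T] [IsLocalRing S] {β : T →+* S}
    (hβ : Function.Surjective β) {y : T} (hy : β y = 0) :
    ∀ r l : List T, IsWeaklyRegular S ((l ++ r).map β) →
      Ideal.span {y} ⊔ Ideal.ofList (l ++ r) = maximalIdeal T →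
      (Ideal.ofList (l.map β)).comap β ≤ Ideal.span {y} ⊔ Ideal.ofList l
  | [], l, _, hmax => by
    have hloc := hβ.isLocalHom β
    rw [List.append_nil] at hmax
    rw [hmax, ← maximalIdeal_comap β]
    refine Ideal.comap_mono (Ideal.span_le.mpr fun s hs => ?_)
    obtain ⟨t, ht, rfl⟩ := List.mem_map.mp hs
    have : t ∈ maximalIdeal T := hmax ▸ Ideal.mem_sup_right (Ideal.subset_span ht)
    rwa [← maximalIdeal_comap β] at this
  | a :: r, l, hreg, hmax => by
    have ih := comap_ofList_le_of_isWeaklyRegular hβ hy r (l ++ [a]) (by simpa using hreg)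
      (by simpa using hmax)
    have ha : a ∈ maximalIdeal T :=
      hmax ▸ Ideal.mem_sup_right (Ideal.subset_span (by simp))
    have hcan : ∀ s : S, β a * s ∈ Ideal.ofList (l.map β) → s ∈ Ideal.ofList (l.map β) := by
      rw [List.map_append, isWeaklyRegular_append_iff, List.map_cons, isWeaklyRegular_cons_iff,
        isSMulRegular_quotient_iff_mem_of_smul_mem] at hreg
      simpa using hreg.2.1
    refine Submodule.le_of_le_smul_of_le_jacobson_bot (IsNoetherian.noetherian _)
      (jacobson_eq_maximalIdeal (⊥ : Ideal T) bot_ne_top).ge fun z hz => ?_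
    have hz' : z ∈ Ideal.span {y} ⊔ Ideal.ofList l ⊔ Ideal.span {a} := by
      rw [sup_assoc, ← Ideal.ofList_singleton a, ← Ideal.ofList_append]
      refine ih (Ideal.comap_mono ?_ hz)
      rw [List.map_append, Ideal.ofList_append]
      exact le_sup_left
    obtain ⟨u, hu, v, hv, rfl⟩ := Submodule.mem_sup.mp hz'
    obtain ⟨c, rfl⟩ := Ideal.mem_span_singleton'.mp hv
    refine Submodule.add_mem_sup hu ?_
    rw [smul_eq_mul, mul_comm c]
    refine Ideal.mul_mem_mul ha (hcan _ ?_)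
    have hβu : β u ∈ Ideal.ofList (l.map β) := by
      have := Ideal.mem_map_of_mem β hu
      rwa [Ideal.map_sup, Ideal.map_span, Set.image_singleton, hy, Ideal.map_ofList,
        Ideal.span_singleton_eq_bot.mpr rfl, bot_sup_eq] at this
    rw [Ideal.mem_comap, map_add, mul_comm c, map_mul] at hz
    exact (Submodule.add_mem_iff_right _ hβu).mp hz

open scoped Pointwise in
theorem isWeaklyRegular_cons_of_ker_eq {T S : Type*} [CommRing T] [CommRing S] {β : T →+* S}
    (hβ : Function.Surjective β) {y : T} (hy : y ∈ nonZeroDivisors T)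
    (hker : RingHom.ker β = Ideal.span {y}) {l : List T} (hl : IsWeaklyRegular S (l.map β)) :
    IsWeaklyRegular T (y :: l) := by
  rw [isWeaklyRegular_cons_iff]
  refine ⟨fun a b hab => (mul_cancel_left_mem_nonZeroDivisors hy).mp hab, ?_⟩
  let := β.toAlgebra
  have h1 : IsWeaklyRegular S l := (isWeaklyRegular_map_algebraMap_iff S S l).mp hl
  have h2 : y • (⊤ : Submodule T T) = LinearMap.ker (Algebra.linearMap T S) := by
    rw [← Submodule.ideal_span_singleton_smul, smul_eq_mul, Ideal.mul_top, ← hker]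
    rfl
  exact (((Submodule.quotEquivOfEq _ _ h2).trans (LinearMap.quotKerEquivOfSurjective
    (Algebra.linearMap T S) hβ)).isWeaklyRegular_congr l).mpr h1

theorem isRegularLocal_of_ker_eq {T S : Type} [CommRing T] [CommRing S] [IsLocalRing T]
    [IsNoetherianRing T] {β : T →+* S} (hβ : Function.Surjective β) {y : T}
    (hy : y ∈ nonZeroDivisors T) (hker : RingHom.ker β = Ideal.span {y}) {l : List T}
    (hl : IsWeaklyRegular S (l.map β)) (hmax : Ideal.span {y} ⊔ Ideal.ofList l = maximalIdeal T) :
    IsRegularLocal T := by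
  have hmax' : Ideal.ofList (y :: l) = maximalIdeal T := by
    rw [Ideal.ofList_cons, hmax]
  refine ⟨inferInstance, y :: l, ?_, hmax'⟩
  rw [isRegular_iff_isWeaklyRegular_of_subset_maximalIdeal]
  · exact isWeaklyRegular_cons_of_ker_eq hβ hy hker hl
  · intro r hr
    rw [← hmax']
    exact Ideal.subset_span hr

theorem exists_isRegularLocal_of_ker_eq {A S C : Type} [CommRing A] [CommRing S]
    [CommRing C] [IsLocalRing A] [IsLocalRing S] [IsLocalRing C] [IsNoetherianRing C]
    [IsAdicComplete (maximalIdeal A) A] [IsAdicComplete (maximalIdeal S) S]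
    {π : A →+* C} {q : S →+* C} (hπ : Function.Surjective π) (hq : Function.Surjective q)
    {x : A} (hxreg : x ∈ nonZeroDivisors A) (hx : RingHom.ker π = Ideal.span {x})
    (hS : IsRegularLocal S) {rs : List S} (hrs : IsWeaklyRegular S rs)
    (hker : RingHom.ker q = Ideal.ofList rs) :
    ∃ (T : Type) (_ : CommRing T) (_ : IsLocalRing T) (ρ : List T), IsRegularLocal T ∧
      (∀ r ∈ ρ, r ∈ maximalIdeal T) ∧ IsRegular T ρ ∧ Nonempty (A ≃+* T ⧸ Ideal.ofList ρ) := by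
  obtain ⟨-, ss, hss, hmax⟩ := hS
  have hrange : Set.range ss.get = {s | s ∈ ss} := Set.range_list_get ss
  obtain ⟨T, _, _, _, y, σ, α, β, hy, hT, hα, hβ, hαy, hβy, hβσ, hαβ⟩ :=
    exists_isLocalRing_over_fiberProduct hπ hq hx (s := ss.get) (by rw [hrange, hmax])
  have hαβ' (t : T) : π (α t) = q (β t) := RingHom.congr_fun hαβ t
  have hσ : (List.ofFn σ).map β = ss := by
    rw [List.map_ofFn]
    have : β ∘ σ = ss.get := funext hβσ
    rw [this, List.ofFn_get]
  have hT' : Ideal.span {y} ⊔ Ideal.ofList (List.ofFn σ) = maximalIdeal T := by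
    rw [← hT]
    exact congrArg (Ideal.span {y} ⊔ ·) (congrArg Ideal.span (Set.ext fun t => List.mem_ofFn))
  have hkerβ : RingHom.ker β = Ideal.span {y} := by
    refine le_antisymm ?_ ((Ideal.span_singleton_le_iff_mem _).mpr hβy)
    have := comap_ofList_le_of_isWeaklyRegular hβ hβy (List.ofFn σ) []
      (by simpa [hσ] using hss.toIsWeaklyRegular) (by simpa using hT')
    rw [List.map_nil, Ideal.ofList_nil, Ideal.ofList_nil, sup_bot_eq] at this
    exact this
  have hTreg : IsRegularLocal T := isRegularLocal_of_ker_eq hβ hy hkerβ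
    (by rw [hσ]; exact hss.toIsWeaklyRegular) hT'
  have hyT : y ∈ maximalIdeal T :=
    hT ▸ Ideal.mem_sup_left (Ideal.mem_span_singleton_self y)
  have hlift : ∀ r ∈ rs, ∃ t, α t = 0 ∧ β t = r := by
    intro r hr
    obtain ⟨t, rfl⟩ := hβ r
    have h1 : α t ∈ Ideal.span {x} := by
      rw [← hx, RingHom.mem_ker, hαβ', ← RingHom.mem_ker, hker]
      exact Ideal.subset_span hr
    obtain ⟨a, ha⟩ := Ideal.mem_span_singleton'.mp h1
    obtain ⟨w, rfl⟩ := hα a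
    refine ⟨t - w * y, ?_, ?_⟩
    · rw [map_sub, map_mul, hαy, ha, sub_self]
    · rw [map_sub, map_mul, hβy, mul_zero, sub_zero]
  choose! c hcα hcβ using hlift
  have hc : (rs.map c).map β = rs := by
    rw [List.map_map]
    exact (List.map_congr_left hcβ).trans rs.map_id
  have hcker : Ideal.ofList (rs.map c) ≤ RingHom.ker α := by
    refine Ideal.span_le.mpr fun t ht => ?_
    obtain ⟨r, hr, rfl⟩ := List.mem_map.mp ht
    exact hcα r hr
  have hαT : RingHom.ker α ≤ maximalIdeal T := le_maximalIdeal (RingHom.ker_ne_top α)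
  have hcT : ∀ t ∈ rs.map c, t ∈ maximalIdeal T := fun t ht => hαT (hcker (Ideal.subset_span ht))
  have hreg : IsWeaklyRegular T (rs.map c) := by
    have h1 : IsWeaklyRegular T (y :: rs.map c) :=
      isWeaklyRegular_cons_of_ker_eq hβ hy hkerβ (by rwa [hc])
    have h2 := isWeaklyRegular_of_perm_of_subset_maximalIdeal h1
      (List.perm_append_singleton y (rs.map c)).symm (by
        intro t ht
        rcases List.mem_cons.mp ht with rfl | ht
        · exact hyT
        · exact hcT t ht)
    exact ((isWeaklyRegular_append_iff T _ _).mp h2).1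
  have hkerα : RingHom.ker α = Ideal.ofList (rs.map c) := by
    refine le_antisymm ?_ hcker
    refine Submodule.le_of_le_smul_of_le_jacobson_bot (IsNoetherian.noetherian _)
      (jacobson_eq_maximalIdeal (⊥ : Ideal T) bot_ne_top).ge fun z hz => ?_
    have h1 : β z ∈ (Ideal.ofList (rs.map c)).map β := by
      rw [Ideal.map_ofList, hc, ← hker, RingHom.mem_ker, ← hαβ', RingHom.mem_ker.mp hz, map_zero]
    obtain ⟨u, hu, huz⟩ := (Ideal.mem_map_iff_of_surjective β hβ).mp h1
    have h2 : z - u ∈ RingHom.ker β := by rw [RingHom.mem_ker, map_sub, huz, sub_self]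
    rw [hkerβ] at h2
    obtain ⟨w, hw⟩ := Ideal.mem_span_singleton'.mp h2
    have h3 : α w * x = 0 := by
      rw [← hαy, ← map_mul, hw, map_sub, RingHom.mem_ker.mp hz,
        RingHom.mem_ker.mp (hcker hu), sub_zero]
    have h4 : w ∈ RingHom.ker α := (mul_right_mem_nonZeroDivisors_eq_zero_iff hxreg).mp h3
    rw [← add_sub_cancel u z, ← hw, mul_comm]
    exact Submodule.add_mem_sup hu (Ideal.mul_mem_mul hyT h4)
  refine ⟨T, _, ‹_›, rs.map c, hTreg, hcT,
    (isRegular_iff_isWeaklyRegular_of_subset_maximalIdeal hcT).mpr hreg, ⟨?_⟩⟩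
  exact (RingHom.quotientKerEquivOfSurjective hα).symm.trans (Ideal.quotEquivOfEq hkerα)

namespace AdicCompletion

variable {R : Type*} [CommRing R] [IsLocalRing R] [IsNoetherianRing R]

theorem ker_evalₐ_maximalIdeal (k : ℕ) : RingHom.ker (evalₐ (maximalIdeal R) k) =
    maximalIdeal (AdicCompletion (maximalIdeal R) R) ^ k := by
  obtain ⟨n, g, hg⟩ := Submodule.fg_iff_exists_fin_generating_family.mp
    (maximalIdeal R).fg_of_isNoetherianRing
  rw [maximalIdeal_eq_map, ker_evalₐ_eq_map_pow (m := maximalIdeal R) (g := g)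
    (fun i => hg ▸ Submodule.subset_span ⟨i, rfl⟩) (hg.symm.le.trans le_sup_left) k]
  exact congrArg (fun J : Ideal R => J.map _ ^ k) hg

instance isNoetherianRing_maximalIdeal :
    IsNoetherianRing (AdicCompletion (maximalIdeal R) R) := by
  obtain ⟨n, g, hg⟩ := Submodule.fg_iff_exists_fin_generating_family.mp
    (maximalIdeal R).fg_of_isNoetherianRing
  exact isNoetherianRing_of_le_sup_sq (m := maximalIdeal R) (g := g)
    (fun i => hg ▸ Submodule.subset_span ⟨i, rfl⟩) (hg.symm.le.trans le_sup_left)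

theorem evalₐ_sub_algebraMap_mem {k : ℕ} {t : AdicCompletion (maximalIdeal R) R} {d : R}
    (h : evalₐ (maximalIdeal R) k t = Ideal.Quotient.mk _ d) :
    t - algebraMap R _ d ∈ maximalIdeal (AdicCompletion (maximalIdeal R) R) ^ k := by
  rw [← ker_evalₐ_maximalIdeal, RingHom.mem_ker, map_sub, h, AlgHom.commutes,
    Ideal.Quotient.algebraMap_eq, sub_self]

/-- A ring homomorphism to a complete local ring that is onto modulo the maximal ideal extends to a
surjection from the completion, whose kernel is generated by the closure of the kernel. -/
theorem exists_surjective_extension {C : Type*} [CommRing C] [IsLocalRing C]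
    [IsAdicComplete (maximalIdeal C) C] (f : R →+* C) {J : Ideal R} (hJ : J ≤ RingHom.ker f)
    (hmap : (maximalIdeal R).map f = maximalIdeal C)
    (hsurj : ∀ c, ∃ d, c - f d ∈ maximalIdeal C)
    (hker : ∀ k d, f d ∈ maximalIdeal C ^ k → d ∈ J ⊔ maximalIdeal R ^ k) :
    ∃ f' : AdicCompletion (maximalIdeal R) R →+* C, Function.Surjective f' ∧
      RingHom.ker f' = J.map (algebraMap R (AdicCompletion (maximalIdeal R) R)) := by
  obtain ⟨f', hf', hf'k⟩ := exists_ringHom_extending (maximalIdeal R) (maximalIdeal C) f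
    (Ideal.map_le_iff_le_comap.mp hmap.le)
  have hcomp : f'.comp (algebraMap R _) = f := RingHom.ext hf'
  have hmap' : (maximalIdeal (AdicCompletion (maximalIdeal R) R)).map f' = maximalIdeal C := by
    rw [maximalIdeal_eq_map, Ideal.map_map, hcomp, hmap]
  refine ⟨f', ?_, le_antisymm (fun t ht => ?_) ?_⟩
  · have : IsHausdorff ((maximalIdeal (AdicCompletion (maximalIdeal R) R)).map f') C := by
      rw [hmap']
      infer_instance
    refine surjective_of_mk_map_comp_surjective
      (I := maximalIdeal (AdicCompletion (maximalIdeal R) R)) f' fun c => ?_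
    obtain ⟨c, rfl⟩ := Ideal.Quotient.mk_surjective c
    obtain ⟨d, hd⟩ := hsurj c
    refine ⟨algebraMap R _ d, ?_⟩
    rw [RingHom.comp_apply, hf', eq_comm, Ideal.Quotient.eq, hmap']
    exact hd
  · set Jc := J.map (algebraMap R (AdicCompletion (maximalIdeal R) R))
    have key : ∀ k, t ∈ Jc ⊔ maximalIdeal (AdicCompletion (maximalIdeal R) R) ^ k := by
      intro k
      obtain ⟨g, -, hg⟩ := exists_evalₐ_eq _ t
      have h1 := hf'k k t (g k) (hg k)
      rw [RingHom.mem_ker.mp ht, zero_sub, neg_mem_iff] at h1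
      have h2 := Ideal.mem_map_of_mem (algebraMap R (AdicCompletion (maximalIdeal R) R))
        (hker k _ h1)
      rw [Ideal.map_sup, Ideal.map_pow, ← maximalIdeal_eq_map] at h2
      have h3 := add_mem (Ideal.mem_sup_right (S := Jc) (evalₐ_sub_algebraMap_mem (hg k))) h2
      rwa [sub_add_cancel] at h3
    rw [← Ideal.Quotient.eq_zero_iff_mem]
    refine IsHausdorff.haus (inferInstance : IsHausdorff
      (maximalIdeal (AdicCompletion (maximalIdeal R) R))
      (AdicCompletion (maximalIdeal R) R ⧸ Jc)) _ fun k => ?_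
    obtain ⟨a, ha, b, hb, rfl⟩ := Submodule.mem_sup.mp (key k)
    rw [SModEq.zero, map_add, Ideal.Quotient.eq_zero_iff_mem.mpr ha, zero_add]
    have : (Ideal.Quotient.mk Jc) b = b • (1 : _ ⧸ Jc) := by
      rw [Algebra.smul_def, mul_one, Ideal.Quotient.algebraMap_eq]
    rw [this]
    exact Submodule.smul_mem_smul hb trivial
  · rw [Ideal.map_le_iff_le_comap]
    intro d hd
    rw [Ideal.mem_comap, RingHom.mem_ker, hf']
    exact hJ hd

end AdicCompletion

theorem IsRegularLocal.adicCompletion {S : Type} [CommRing S] [IsLocalRing S]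
    [IsNoetherianRing S] (hS : IsRegularLocal S) :
    IsRegularLocal (AdicCompletion (maximalIdeal S) S) := by
  obtain ⟨-, rs, hrs, hspan⟩ := hS
  have hmap : Ideal.ofList (rs.map (algebraMap S (AdicCompletion (maximalIdeal S) S))) =
      maximalIdeal (AdicCompletion (maximalIdeal S) S) := by
    rw [← Ideal.map_ofList, AdicCompletion.maximalIdeal_eq_map]
    exact congrArg _ hspan
  refine ⟨inferInstance, _, (isRegular_iff_isWeaklyRegular_of_subset_maximalIdeal ?_).mpr
    (hrs.toIsWeaklyRegular.of_flat (S := AdicCompletion (maximalIdeal S) S)), hmap⟩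
  intro r hr
  rw [← hmap]
  exact Ideal.subset_span hr

/-!
STATEMENT 9: Let `R` be a Noetherian local ring with maximal ideal `m` and
residue field `k`, and suppose `x ∈ m \ m²` is a nonzerodivisor.  If `R/(x)`
is a complete intersection ring, then `R` is a complete intersection ring.
-/
theorem complete_intersection_of_quotient_by_nonzerodivisor
    (R : Type) [CommRing R] [IsLocalRing R] [IsNoetherianRing R]
    (x : R) (hx : x ∈ maximalIdeal R) (hx2 : x ∉ (maximalIdeal R) ^ 2)
    (hreg : x ∈ nonZeroDivisors R)
    [IsLocalRing (R ⧸ Ideal.span {x})]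
    (hq : IsCompleteIntersectionRing (R ⧸ Ideal.span {x})) :
    IsCompleteIntersectionRing R := by
  obtain ⟨hN, S, _, _, rs, hS, -, hrs, ⟨e⟩⟩ := hq
  have := hS.1
  have hmkmap := map_maximalIdeal_of_surjective (Ideal.Quotient.mk (Ideal.span {x}))
    Ideal.Quotient.mk_surjective
  obtain ⟨π, hπ, hπker⟩ := AdicCompletion.exists_surjective_extension
    (C := AdicCompletion (maximalIdeal (R ⧸ Ideal.span {x})) (R ⧸ Ideal.span {x}))
    (J := Ideal.span {x}) ((algebraMap (R ⧸ Ideal.span {x}) _).comp (Ideal.Quotient.mk _))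
    (fun d hd => by
      rw [RingHom.mem_ker, RingHom.comp_apply, Ideal.Quotient.eq_zero_iff_mem.mpr hd, map_zero])
    (by rw [← Ideal.map_map, hmkmap, AdicCompletion.maximalIdeal_eq_map])
    (fun c => by
      obtain ⟨g, -, hg⟩ := AdicCompletion.exists_evalₐ_eq _ c
      obtain ⟨d, hd⟩ := Ideal.Quotient.mk_surjective (g 1)
      have := AdicCompletion.evalₐ_sub_algebraMap_mem (hg 1)
      rw [pow_one] at this
      exact ⟨d, by rwa [RingHom.comp_apply, hd]⟩)
    (fun k d hd => by
      rw [← AdicCompletion.ker_evalₐ_maximalIdeal, RingHom.mem_ker, RingHom.comp_apply,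
        AlgHom.commutes, Ideal.Quotient.algebraMap_eq, Ideal.Quotient.eq_zero_iff_mem, ← hmkmap,
        ← Ideal.map_pow, Ideal.mem_quotient_iff_mem_sup, sup_comm] at hd
      exact hd)
  set f : S →+* AdicCompletion (maximalIdeal (R ⧸ Ideal.span {x})) (R ⧸ Ideal.span {x}) :=
    e.symm.toRingHom.comp (Ideal.Quotient.mk _) with hf
  have hfs : Function.Surjective f := e.symm.surjective.comp Ideal.Quotient.mk_surjective
  have hfker : RingHom.ker f = Ideal.ofList rs := by
    ext s
    rw [RingHom.mem_ker, hf, RingHom.comp_apply]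
    exact (EmbeddingLike.map_eq_zero_iff (f := e.symm)).trans Ideal.Quotient.eq_zero_iff_mem
  obtain ⟨q, hq, hqker⟩ := AdicCompletion.exists_surjective_extension f hfker.ge
    (map_maximalIdeal_of_surjective f hfs)
    (fun c => (hfs c).imp fun d hd => by rw [hd, sub_self]; exact zero_mem _)
    (fun k d hd => by
      rw [← map_maximalIdeal_of_surjective f hfs, ← Ideal.map_pow, ← Ideal.mem_comap,
        Ideal.comap_map_of_surjective' f hfs, hfker, sup_comm] at hd
      exact hd)
  rw [Ideal.map_span, Set.image_singleton] at hπker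
  rw [Ideal.map_ofList] at hqker
  have hxreg : algebraMap R (AdicCompletion (maximalIdeal R) R) x ∈
      nonZeroDivisors (AdicCompletion (maximalIdeal R) R) := by
    have h := Module.Flat.isSMulRegular_of_nonZeroDivisors
      (M := AdicCompletion (maximalIdeal R) R) hreg
    rw [mem_nonZeroDivisors_iff_right]
    intro z hz
    refine h ?_
    simp only [Algebra.smul_def]
    rw [mul_comm, hz, mul_zero]
  obtain ⟨T, i₁, i₂, ρ, hT, hρ, hρreg, hiso⟩ := exists_isRegularLocal_of_ker_eq hπ hq hxreg hπker
    hS.adicCompletion (hrs.toIsWeaklyRegular.of_flat (S := AdicCompletion (maximalIdeal S) S)) hqker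
  exact ⟨inferInstance, T, i₁, i₂, ρ, hT, hρ, hρreg, hiso⟩
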